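/- arXiv:1208.2579 — 2 statements merged into one kernel-verified Lean document; each statement's English description precedes it below -/
import Mathlib

section
/- Suppose λ ≥ μ ≥ ℵ₀, μ⁺ < λ, D₀ is a λ-regular filter on a set I of cardinality λ, g* ∉ G, (I, D₀, G ∪ {g*}) is a (λ, μ)-good triple, and range(g*) = μ. Let M be a model of the random graph with vertex set μ and edge relation R. Then there is a filter D ⊇ D₀ such that (I, D, G) is a (λ, μ)-good triple, and there is a sequence ⟨f_γ : γ < μ⁺⟩ of functions I → μ such that for every ultrafilter D* on I extending D: (1) {t ∈ I : f_γ(t) = f_δ(t)} ∉ D* for all γ < δ < μ⁺; (2) for every finite u ⊆ μ⁺ there is h : I → μ such that for all γ ∈ u, {t ∈ I : h(t) R f_γ(t)} ∈ D* if and only if γ is even; (3) there is no h : I → μ such that for every γ < μ⁺, {t ∈ I : h(t) R f_γ(t)} ∈ D* if and only if γ is even. In particular, the ultrapower M^I/D* is not μ⁺⁺-saturated for any ultrafilter D* ⊇ D. -/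
open Cardinal Set

universe u

/-- `A = ∅ mod D`: the complement of `A` belongs to the filter `D`. -/
def ZeroMod {I : Type u} (D : Filter I) (A : Set I) : Prop := Aᶜ ∈ D

/-- `A ≠ ∅ mod D`: the complement of `A` does not belong to the filter `D`. -/
def NonzeroMod {I : Type u} (D : Filter I) (A : Set I) : Prop := Aᶜ ∉ D

/-- `A ⊆ B mod D`. -/
def SubsetMod {I : Type u} (D : Filter I) (A B : Set I) : Prop := ZeroMod D (A \ B)

/-- `A = B mod D`. -/
def EqMod {I : Type u} (D : Filter I) (A B : Set I) : Prop := SubsetMod D A B ∧ SubsetMod D B A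

/-- `D` is a `lam`-regular filter on `I`: there is a family `⟨X i : i < lam⟩` of members of `D`
such that every `t ∈ I` belongs to only finitely many of the `X i`. -/
def IsRegularFilter {I : Type u} (lam : Cardinal.{u}) (D : Filter I) : Prop :=
  ∃ X : Ordinal.{u} → Set I, (∀ i, i < lam.ord → X i ∈ D) ∧
    ∀ t : I, {i : Ordinal.{u} | i < lam.ord ∧ t ∈ X i}.Finite

/-- `f : I → ℕ` is `D`-nonstandard. -/
def IsNonstandard {I : Type u} (D : Filter I) (f : I → ℕ) : Prop := ∀ n : ℕ, {t | n < f t} ∈ D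

/-- `f <_D g`. -/
def ltD {I : Type u} (D : Filter I) (f g : I → ℕ) : Prop := {t | f t < g t} ∈ D

/-- `f ≤_D g`. -/
def leD {I : Type u} (D : Filter I) (f g : I → ℕ) : Prop := {t | f t ≤ g t} ∈ D

/-- Flexibility for a family of sets (e.g. `D.sets`): for every nonstandard `f` there is a
`theta`-indexed family of members below `f`. -/
def IsFlexibleSets {I : Type u} (theta : Cardinal.{u}) (F : Set (Set I)) : Prop :=
  ∀ f : I → ℕ, (∀ n : ℕ, {t | n < f t} ∈ F) →
    ∃ X : Ordinal.{u} → Set I, (∀ α, α < theta.ord → X α ∈ F) ∧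
      ∀ t : I, #{α : Ordinal.{u} // α < theta.ord ∧ t ∈ X α} ≤ (f t : Cardinal)

/-- `D` is a `theta`-flexible filter. -/
def IsFlexible {I : Type u} (theta : Cardinal.{u}) (D : Filter I) : Prop :=
  IsFlexibleSets theta D.sets

/-- `F` (e.g. the sets of a filter) is `mu⁺`-good: every monotonic map from finite subsets of `mu`
into `F` has a multiplicative refinement. Finite subsets of `mu` are represented as finite sets of
ordinals `< mu.ord`. -/
def IsGoodSets {I : Type u} (mu : Cardinal.{u}) (F : Set (Set I)) : Prop :=
  ∀ f : Finset Ordinal.{u} → Set I,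
    (∀ u : Finset Ordinal.{u}, ↑u ⊆ Set.Iio mu.ord → f u ∈ F) →
    (∀ u v : Finset Ordinal.{u}, ↑v ⊆ Set.Iio mu.ord → u ⊆ v → f v ⊆ f u) →
    ∃ f' : Finset Ordinal.{u} → Set I,
      (∀ u, ↑u ⊆ Set.Iio mu.ord → f' u ∈ F) ∧
      (∀ u, ↑u ⊆ Set.Iio mu.ord → f' u ⊆ f u) ∧
      ∀ u v, ↑u ⊆ Set.Iio mu.ord → ↑v ⊆ Set.Iio mu.ord → f' u ∩ f' v = f' (u ∪ v)

/-- The filter `D` is `mu⁺`-good. -/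
def IsGoodFilter {I : Type u} (mu : Cardinal.{u}) (D : Filter I) : Prop := IsGoodSets mu D.sets

/-- An element of `FIN(G)`: a function whose domain is a finite subset of `G`, with
`h(g) ∈ range(g)` for each `g` in the domain. Functions in `G` take ordinal values. -/
structure PartialAssignment (I : Type u) (G : Set (I → Ordinal.{u})) where
  dom : Finset (I → Ordinal.{u})
  dom_sub : ↑dom ⊆ G
  val : (I → Ordinal.{u}) → Ordinal.{u}
  val_mem : ∀ g ∈ dom, val g ∈ Set.range g

/-- The set `A_h = {t ∈ I : g(t) = h(g) for all g ∈ dom h}`. -/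
def PartialAssignment.Aset {I : Type u} {G : Set (I → Ordinal.{u})}
    (h : PartialAssignment I G) : Set I :=
  {t | ∀ g ∈ h.dom, g t = h.val g}

/-- `G` is independent mod `D`: `A_h ≠ ∅ mod D` for every `h ∈ FIN(G)`. -/
def IndependentMod {I : Type u} (D : Filter I) (G : Set (I → Ordinal.{u})) : Prop :=
  ∀ h : PartialAssignment I G, NonzeroMod D h.Aset

/-- `(I, D, G)` is a `(lam, mu)`-pre-good triple: `|I| = lam`, `D` is a `lam`-regular filter,
`G` is a family of functions from `I` to `mu` (ordinals `< mu.ord`), independent mod `D`. -/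
def IsPreGoodTriple {I : Type u} (lam mu : Cardinal.{u}) (D : Filter I)
    (G : Set (I → Ordinal.{u})) : Prop :=
  #I = lam ∧ IsRegularFilter lam D ∧ (∀ g ∈ G, ∀ t : I, g t < mu.ord) ∧ IndependentMod D G

/-- `(I, D, G)` is a `(lam, mu)`-good triple: pre-good and `D` maximal among filters modulo which
`G` is independent. -/
def IsGoodTriple {I : Type u} (lam mu : Cardinal.{u}) (D : Filter I)
    (G : Set (I → Ordinal.{u})) : Prop :=
  IsPreGoodTriple lam mu D G ∧
    ∀ D' : Filter I, (∀ A ∈ D, A ∈ D') → IndependentMod D' G → D' = D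

/-- `A` is supported by `G` mod `D`: there is a partition of `I` into sets of the form `A_h`,
`h ∈ FIN(G)`, each of which is `⊆ A mod D` or disjoint from `A mod D`. -/
def SupportedBy {I : Type u} (D : Filter I) (G : Set (I → Ordinal.{u})) (A : Set I) : Prop :=
  ∃ P : Set (Set I),
    (∀ X ∈ P, ∃ h : PartialAssignment I G, X = h.Aset) ∧
    (∀ X ∈ P, ∀ Y ∈ P, X ≠ Y → X ∩ Y = ∅) ∧
    ⋃₀ P = Set.univ ∧
    ∀ X ∈ P, SubsetMod D X A ∨ ZeroMod D (X ∩ A)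

/-- `R` is the edge relation of a model of the random graph with vertex set `mu`
(identified with the ordinals `< mu.ord`). -/
def IsRandomGraphOn (mu : Cardinal.{u}) (R : Ordinal.{u} → Ordinal.{u} → Prop) : Prop :=
  (∀ a b, a < mu.ord → b < mu.ord → (R a b ↔ R b a)) ∧
  (∀ a, a < mu.ord → ¬ R a a) ∧
  ∀ U V : Finset Ordinal.{u}, ↑U ⊆ Set.Iio mu.ord → ↑V ⊆ Set.Iio mu.ord → Disjoint U V →
    ∃ x, x < mu.ord ∧ (∀ a ∈ U, R x a) ∧ ∀ b ∈ V, ¬ R x b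

/-- An ordinal `γ = β + n` (`β` limit or zero, `n < ω`) is even iff `n` is even,
equivalently iff `γ = 2·δ` for some ordinal `δ`. -/
def EvenOrdinal (γ : Ordinal.{u}) : Prop := ∃ δ : Ordinal.{u}, γ = 2 * δ

/-- `lcf(ℵ₀, D)`: the least cardinality of a family `S` of `D`-nonstandard functions
such that every `D`-nonstandard `g` satisfies `f ≤_D g` for some `f ∈ S`. -/
noncomputable def lcfAleph0 {I : Type u} (D : Filter I) : Cardinal.{u} :=
  sInf { c : Cardinal.{u} | ∃ S : Set (I → ℕ), #S = c ∧ (∀ f ∈ S, IsNonstandard D f) ∧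
    ∀ g : I → ℕ, IsNonstandard D g → ∃ f ∈ S, leD D f g }

/-- A filter on a Boolean algebra. -/
def IsBAFilter {B : Type u} [BooleanAlgebra B] (E : Set B) : Prop :=
  ⊤ ∈ E ∧ (∀ a b : B, a ∈ E → a ≤ b → b ∈ E) ∧ ∀ a b : B, a ∈ E → b ∈ E → a ⊓ b ∈ E

/-- An ultrafilter on a Boolean algebra: a maximal proper filter. -/
def IsBAUltrafilter {B : Type u} [BooleanAlgebra B] (E : Set B) : Prop :=
  IsBAFilter E ∧ ⊥ ∉ E ∧ ∀ E' : Set B, IsBAFilter E' → ⊥ ∉ E' → E ⊆ E' → E' = E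

/-- `E` is a `theta`-complete subset of the complete Boolean algebra `B`: every subset of `E`
of cardinality `< theta` has its infimum in `E`. -/
def IsThetaComplete {B : Type u} [CompleteBooleanAlgebra B] (theta : Cardinal.{u})
    (E : Set B) : Prop :=
  ∀ S : Set B, S ⊆ E → #S < theta → sInf S ∈ E

/-- `X ⊆ B` is `rho⁺`-good: every monotonic `fss(rho)`-indexed sequence of members of `X`
has a multiplicative refinement in `X`. -/
def IsGoodBA {B : Type u} [BooleanAlgebra B] (rho : Cardinal.{u}) (X : Set B) : Prop :=
  ∀ a : Finset Ordinal.{u} → B,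
    (∀ u, ↑u ⊆ Set.Iio rho.ord → a u ∈ X) →
    (∀ u v, ↑v ⊆ Set.Iio rho.ord → u ⊆ v → a v ≤ a u) →
    ∃ b : Ordinal.{u} → B, (∀ α, α < rho.ord → b α ∈ X) ∧
      ∀ u : Finset Ordinal.{u}, ↑u ⊆ Set.Iio rho.ord → u.inf b ≤ a u

/-- `kappa` is a measurable cardinal: uncountable, carrying a nonprincipal `kappa`-complete
ultrafilter. -/
def IsMeasurableCard (kappa : Cardinal.{u}) : Prop :=
  ℵ₀ < kappa ∧ ∃ (K : Type u) (U : Ultrafilter K), #K = kappa ∧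
    (∀ a : K, ({a} : Set K) ∉ U) ∧
    ∀ S : Set (Set K), (∀ A ∈ S, A ∈ U) → #S < kappa → ⋂₀ S ∈ U

/-- `kappa` is weakly compact: uncountable and every 2-coloring of pairs of ordinals `< kappa.ord`
has a homogeneous set of cardinality `kappa`. -/
def IsWeaklyCompactCard (kappa : Cardinal.{u}) : Prop :=
  ℵ₀ < kappa ∧ ∀ c : Ordinal.{u} → Ordinal.{u} → Bool,
    ∃ U : Set Ordinal.{u}, U ⊆ Set.Iio kappa.ord ∧ #U = Cardinal.lift.{u+1} kappa ∧
      ∃ v : Bool, ∀ ε ∈ U, ∀ ζ ∈ U, ε < ζ → c ε ζ = v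

/-- A filter can be enlarged to one maximal among those keeping all sets of `K` nonzero. -/
theorem exists_maximal_filter {I : Type u} (K : Set (Set I)) (D : Filter I)
    (hD : ∀ A ∈ K, NonzeroMod D A) :
    ∃ D' ≤ D, (∀ A ∈ K, NonzeroMod D' A) ∧
      ∀ D'' ≤ D', (∀ A ∈ K, NonzeroMod D'' A) → D'' = D' := by
  obtain ⟨m, hm, hmax⟩ := zorn_le_nonempty₀ (α := (Filter I)ᵒᵈ)
    {E | ∀ A ∈ K, NonzeroMod (OrderDual.ofDual E) A} (fun c hc hchain y hy => by
      refine ⟨OrderDual.toDual (⨅ E : c, OrderDual.ofDual E.1), ?_, fun z hz => ?_⟩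
      · intro A hA hmem
        have hne : Nonempty c := ⟨⟨y, hy⟩⟩
        have hmem' : Aᶜ ∈ ⨅ E : c, OrderDual.ofDual E.1 := hmem
        rw [Filter.mem_iInf_of_directed] at hmem'
        · obtain ⟨E, hE⟩ := hmem'
          exact hc E.2 A hA hE
        · intro a b
          rcases hchain.total a.2 b.2 with h | h
          · exact ⟨b, h, le_rfl⟩
          · exact ⟨a, le_rfl, h⟩
      · exact OrderDual.ofDual_le_ofDual.1
          (iInf_le (fun E : c => OrderDual.ofDual E.1) ⟨z, hz⟩)) (OrderDual.toDual D) hD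
  exact ⟨OrderDual.ofDual m, hm, hmax.prop, fun E hle hE =>
    le_antisymm hle (hmax.le_of_ge (y := OrderDual.toDual E) hE hle)⟩

/-- The set of points at which `F` takes the finitely many values prescribed by `s`. -/
def cylinder {I : Type u} {ι : Type*} (F : ι → I → Ordinal.{u}) (s : Finset (ι × Ordinal.{u})) :
    Set I :=
  {t | ∀ x ∈ s, F x.1 t = x.2}

/-- `s` is the graph of a finite partial function, and is contained in `V`. -/
def IsPartialFun {ι : Type*} (V : Set (ι × Ordinal.{u})) (s : Finset (ι × Ordinal.{u})) : Prop :=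
  ↑s ⊆ V ∧ ∀ x ∈ s, ∀ y ∈ s, x.1 = y.1 → x.2 = y.2

/-- The condition `s` decides `B` modulo `D`. -/
def Decides {I : Type u} {ι : Type*} (D : Filter I) (F : ι → I → Ordinal.{u})
    (s : Finset (ι × Ordinal.{u})) (B : Set I) : Prop :=
  (∀ᶠ t in D, t ∈ cylinder F s → t ∈ B) ∨ ∀ᶠ t in D, t ∈ cylinder F s → t ∉ B

theorem cylinder_anti {I : Type u} {ι : Type*} {F : ι → I → Ordinal.{u}}
    {s s' : Finset (ι × Ordinal.{u})} (h : s ⊆ s') : cylinder F s' ⊆ cylinder F s :=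
  fun _ ht x hx => ht x (h hx)

theorem Decides.mono {I : Type u} {ι : Type*} {D : Filter I} {F : ι → I → Ordinal.{u}}
    {s s' : Finset (ι × Ordinal.{u})} {B : Set I} (hs : Decides D F s B) (h : s ⊆ s') :
    Decides D F s' B :=
  hs.imp (fun H => H.mono fun _ ht h' => ht (cylinder_anti h h'))
    (fun H => H.mono fun _ ht h' => ht (cylinder_anti h h'))

theorem IsPartialFun.mono {ι : Type*} {V : Set (ι × Ordinal.{u})}
    {s s' : Finset (ι × Ordinal.{u})} (hs : IsPartialFun V s') (h : s ⊆ s') : IsPartialFun V s :=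
  ⟨fun _ hx => hs.1 (h hx), fun x hx y hy => hs.2 x (h hx) y (h hy)⟩

theorem IsPartialFun.union {ι : Type*} [DecidableEq (ι × Ordinal.{u})] {V : Set (ι × Ordinal.{u})}
    {r s : Finset (ι × Ordinal.{u})} (hr : IsPartialFun V r) (hs : IsPartialFun V s)
    (h : ∀ x ∈ r, ∀ y ∈ s, x.1 = y.1 → x.2 = y.2) : IsPartialFun V (r ∪ s) := by
  refine ⟨fun x hx => ?_, fun x hx y hy hxy => ?_⟩
  · rcases Finset.mem_union.1 (Finset.mem_coe.1 hx) with hx | hx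
    exacts [hr.1 hx, hs.1 hx]
  · rcases Finset.mem_union.1 hx with hx | hx <;> rcases Finset.mem_union.1 hy with hy | hy
    exacts [hr.2 x hx y hy hxy, h x hx y hy hxy, (h y hy x hx hxy.symm).symm, hs.2 x hx y hy hxy]

/-- Modulo a maximal filter keeping a family independent, every set is decided densely often. -/
theorem exists_decides {I : Type u} {ι : Type*} {D : Filter I} {F : ι → I → Ordinal.{u}}
    {V : Set (ι × Ordinal.{u})} (hpos : ∀ s, IsPartialFun V s → NonzeroMod D (cylinder F s))
    (hmax : ∀ D' ≤ D, (∀ s, IsPartialFun V s → NonzeroMod D' (cylinder F s)) → D' = D)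
    (B : Set I) (s : Finset (ι × Ordinal.{u})) (hs : IsPartialFun V s) :
    ∃ s', IsPartialFun V s' ∧ s ⊆ s' ∧ Decides D F s' B := by
  classical
  by_cases h : ∀ᶠ t in D, t ∈ cylinder F s → t ∈ B
  · exact ⟨s, hs, subset_rfl, Or.inl h⟩
  have hne : D ⊓ Filter.principal {t | t ∈ cylinder F s → t ∈ B} ≠ D := by
    intro he
    exact h (Filter.le_principal_iff.1 (inf_eq_left.1 he))
  have h2 : ¬ ∀ r, IsPartialFun V r → NonzeroMod
      (D ⊓ Filter.principal {t | t ∈ cylinder F s → t ∈ B}) (cylinder F r) :=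
    fun H => hne (hmax _ inf_le_left H)
  push Not at h2
  obtain ⟨r, hr, hr2⟩ := h2
  have hr3 : ∀ᶠ t in D, (t ∈ cylinder F s → t ∈ B) → t ∉ cylinder F r := by
    have := not_not.1 hr2
    rwa [Filter.mem_inf_principal] at this
  refine ⟨r ∪ s, hr.union hs ?_, Finset.subset_union_right, Or.inr ?_⟩
  · intro x hx y hy hxy
    by_contra hv
    refine hpos r hr (hr3.mono fun t ht => fun htr => ht (fun hts => ?_) htr)
    exact absurd (by rw [← htr x hx, ← hts y hy, hxy]) hv
  · exact hr3.mono fun t ht h3 hB => ht (fun _ => hB) (cylinder_anti Finset.subset_union_left h3)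

/-- Closing off under a finitary operation whose values have size at most `κ`. -/
theorem exists_closed_set {α : Type*} {κ : Cardinal} (hκ : ℵ₀ ≤ κ) (c : Finset α → Set α)
    (hc : ∀ s, #(c s) ≤ κ) : ∃ T : Set α, #T ≤ κ ∧ ∀ s : Finset α, ↑s ⊆ T → c s ⊆ T := by
  let step : Set α → Set α := fun T => T ∪ ⋃ s : {s : Finset α // ↑s ⊆ T}, c s.1
  let T : ℕ → Set α := fun n => step^[n] ∅
  have hT : ∀ n, T (n + 1) = step (T n) := fun n => Function.iterate_succ_apply' _ _ _
  have hmono : Monotone T := monotone_nat_of_le_succ fun n => by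
    rw [hT]; exact subset_union_left
  have hfin : ∀ S : Set α, #S ≤ κ → #{s : Finset α // ↑s ⊆ S} ≤ κ := by
    intro S hS
    have h1 : #{s : Finset α // ↑s ⊆ S} ≤ #(Finset S) := by
      classical
      refine mk_le_of_injective (f := fun s => s.1.subtype (· ∈ S)) ?_
      intro s s' h
      have h2 := congrArg (fun u => u.map (Function.Embedding.subtype (· ∈ S))) h
      simp only [Finset.subtype_map] at h2
      rw [Finset.filter_true_of_mem (fun x hx => s.2 hx),
        Finset.filter_true_of_mem (fun x hx => s'.2 hx)] at h2
      exact Subtype.ext h2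
    refine h1.trans ?_
    rcases finite_or_infinite S with h | h
    · have : Finite (Finset S) := inferInstance
      exact (mk_le_aleph0 (α := Finset S)).trans hκ
    · rwa [mk_finset_of_infinite]
  have hcard : ∀ n, #(T n) ≤ κ := by
    intro n
    induction n with
    | zero => simp [T]
    | succ n ih =>
      rw [hT]
      refine (mk_union_le _ _).trans (add_le_of_le hκ ih ?_)
      refine (mk_iUnion_le _).trans ((mul_le_mul' (hfin _ ih) (ciSup_le' fun s => hc _)).trans ?_)
      rw [mul_eq_self hκ]
  refine ⟨⋃ n, T n, ?_, fun s hs => ?_⟩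
  · have h := mk_iUnion_le_lift T
    simp only [Cardinal.lift_uzero, mk_nat, Cardinal.lift_aleph0] at h
    refine h.trans ((mul_le_mul' hκ (ciSup_le' hcard)).trans (mul_eq_self hκ).le)
  · obtain ⟨n, hn⟩ : ∃ n, ↑s ⊆ T n :=
      Directed.exists_mem_subset_of_finset_subset_biUnion hmono.directed_le hs
    refine subset_trans ?_ (subset_iUnion T (n + 1))
    rw [hT]
    exact fun x hx => Or.inr (mem_iUnion.2 ⟨⟨s, hn⟩, hx⟩)

/-- Given `mu` many sets, there is a set `T` of size `mu` such that any condition can be extended,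
using only elements of `T`, to decide any one of them. -/
theorem exists_support {I : Type u} {ι : Type (u + 1)} {mu : Cardinal.{u}} (hmu : ℵ₀ ≤ mu)
    {D : Filter I} {F : ι → I → Ordinal.{u}} {V : Set (ι × Ordinal.{u})}
    (hV : ∀ x ∈ V, x.2 < mu.ord)
    (hdec : ∀ B s, IsPartialFun V s → ∃ s', IsPartialFun V s' ∧ s ⊆ s' ∧ Decides D F s' B)
    (B : Ordinal.{u} → Set I) :
    ∃ T : Set (ι × Ordinal.{u}), #T ≤ Cardinal.lift.{u + 1} mu ∧
      ∀ β < mu.ord, ∀ q, IsPartialFun V q →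
        ∃ q', IsPartialFun V q' ∧ q ⊆ q' ∧ (∀ x ∈ q', x ∈ q ∨ x ∈ T) ∧ Decides D F q' (B β) := by
  classical
  have hκ : ℵ₀ ≤ Cardinal.lift.{u + 1} mu := aleph0_le_lift.2 hmu
  have hIio : #(Iio mu.ord) = Cardinal.lift.{u + 1} mu := by rw [mk_Iio_ordinal, card_ord]
  have hdec' : ∀ s (β : Ordinal.{u}), ∃ s', IsPartialFun V s →
      IsPartialFun V s' ∧ s ⊆ s' ∧ Decides D F s' (B β) := by
    intro s β
    by_cases hs : IsPartialFun V s
    · obtain ⟨s', h⟩ := hdec (B β) s hs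
      exact ⟨s', fun _ => h⟩
    · exact ⟨s, fun h => absurd h hs⟩
  choose dec hdecs using hdec'
  let fiber : ι → Set (ι × Ordinal.{u}) := fun i => {x ∈ V | x.1 = i}
  have hfiber : ∀ i, #(fiber i) ≤ Cardinal.lift.{u + 1} mu := by
    intro i
    rw [← hIio]
    refine mk_le_of_injective (f := fun x : fiber i => (⟨x.1.2, hV _ x.2.1⟩ : Iio mu.ord)) ?_
    intro x y h
    exact Subtype.ext (Prod.ext (x.2.2.trans y.2.2.symm) (congrArg Subtype.val h))
  obtain ⟨T, hT, hcl⟩ := exists_closed_set hκ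
    (fun s => ⋃ β : Iio mu.ord, ⋃ y : dec s β, fiber y.1.1) (by
      intro s
      refine (mk_iUnion_le _).trans ((mul_le_mul' hIio.le (ciSup_le' fun β => ?_)).trans
        (mul_eq_self hκ).le)
      refine (mk_iUnion_le _).trans ((mul_le_mul' (mk_le_aleph0.trans hκ)
        (ciSup_le' fun y => hfiber _)).trans (mul_eq_self hκ).le))
  refine ⟨T, hT, fun β hβ q hq => ?_⟩
  have hs : IsPartialFun V (q.filter (· ∈ T)) := hq.mono (Finset.filter_subset _ _)
  obtain ⟨h1, h2, h3⟩ := hdecs _ β hs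
  have hmem : ∀ y ∈ dec (q.filter (· ∈ T)) β, fiber y.1 ⊆ T := by
    intro y hy
    have h := hcl (q.filter (· ∈ T)) fun x hx => (Finset.mem_filter.1 (Finset.mem_coe.1 hx)).2
    intro x hx
    refine h ?_
    simp only [mem_iUnion]
    exact ⟨⟨β, hβ⟩, ⟨y, hy⟩, hx⟩
  refine ⟨q ∪ dec (q.filter (· ∈ T)) β, hq.union h1 ?_, Finset.subset_union_left, ?_,
    h3.mono Finset.subset_union_right⟩
  · intro x hx y hy hxy
    have hxT : x ∈ T := hmem y hy ⟨hq.1 hx, hxy⟩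
    exact h1.2 x (h2 (Finset.mem_filter.2 ⟨hx, hxT⟩)) y hy hxy
  · intro x hx
    rcases Finset.mem_union.1 hx with hx | hx
    · exact Or.inl hx
    · exact Or.inr (hmem x hx ⟨h1.1 hx, rfl⟩)

/-- Any `mu` ordinals below `mu⁺` are bounded below `mu⁺`. -/
theorem exists_bound_lt_succ_ord {mu : Cardinal.{u}} (hmu : ℵ₀ ≤ mu) {ι : Type (u + 1)}
    (T : Set (ι × Ordinal.{u})) (hT : #T ≤ Cardinal.lift.{u + 1} mu) (r : ι → Ordinal.{u}) :
    ∃ δ < (Order.succ mu).ord, ∀ x ∈ T, r x.1 < (Order.succ mu).ord → r x.1 < δ := by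
  let W : Set Ordinal.{u} := {γ | γ < (Order.succ mu).ord ∧ ∃ x ∈ T, r x.1 = γ}
  have hW : #W ≤ Cardinal.lift.{u + 1} mu :=
    (mk_le_mk_of_subset (show W ⊆ (fun x => r x.1) '' T from
      fun γ ⟨_, x, hx, h⟩ => ⟨x, hx, h⟩)).trans
      (mk_image_le.trans hT)
  have hlim : Order.IsSuccLimit (Order.succ mu).ord :=
    isSuccLimit_ord (hmu.trans (Order.le_succ mu))
  have hsup : sSup W < (Order.succ mu).ord := by
    refine Ordinal.sSup_lt_of_lt_cof ?_ fun i hi => hi.1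
    rw [← Ordinal.lift_cof, (isRegular_succ hmu).cof_ord]
    exact hW.trans_lt (Cardinal.lift_lt.2 (Order.lt_succ mu))
  refine ⟨Order.succ (sSup W), hlim.succ_lt hsup, fun x hx hr => Order.lt_succ_iff.2 ?_⟩
  exact le_csSup ⟨(Order.succ mu).ord, fun y hy => hy.1.le⟩ ⟨hr, x, hx, rfl⟩

/-- There are `mu⁺` independent functions from `mu` to `mu`. -/
theorem exists_independent_functions {mu : Cardinal.{u}} (hmu : ℵ₀ ≤ mu) :
    ∃ F : Ordinal.{u} → Ordinal.{u} → Ordinal.{u}, (∀ γ α, F γ α < mu.ord) ∧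
      ∀ (s : Finset Ordinal.{u}) (v : Ordinal.{u} → Ordinal.{u}),
        (∀ γ ∈ s, γ < (Order.succ mu).ord ∧ v γ < mu.ord) →
        ∃ α < mu.ord, ∀ γ ∈ s, F γ α = v γ := by
  classical
  have hpos : 0 < mu.ord := (isSuccLimit_ord hmu).bot_lt
  have hIio : #(Iio mu.ord) = Cardinal.lift.{u + 1} mu := by rw [mk_Iio_ordinal, card_ord]
  have hκ : ℵ₀ ≤ Cardinal.lift.{u + 1} mu := aleph0_le_lift.2 hmu
  have : Infinite (Iio mu.ord) := by rwa [infinite_iff, hIio]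
  obtain ⟨e⟩ : Nonempty (Iio mu.ord ≃
      Finset (Iio mu.ord) × Finset (Finset (Iio mu.ord) × Iio mu.ord)) := by
    rw [← Cardinal.eq]
    simp only [mk_prod, Cardinal.lift_id, mk_finset_of_infinite, hIio, mul_eq_self hκ]
  obtain ⟨X⟩ : Nonempty (Iio (Order.succ mu).ord ↪ Set (Iio mu.ord)) := by
    have h2 : (2 : Cardinal.{u + 1}) ^ Cardinal.lift.{u + 1} mu =
        Cardinal.lift.{u + 1} (2 ^ mu) := by simp
    rw [← Cardinal.le_def, mk_set, hIio, mk_Iio_ordinal, card_ord, h2, Cardinal.lift_le]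
    exact Order.succ_le_of_lt (cantor mu)
  let Y : Ordinal.{u} → Set (Iio mu.ord) := fun γ =>
    if h : γ < (Order.succ mu).ord then X ⟨γ, h⟩ else ∅
  let F0 : Ordinal.{u} → Iio mu.ord → Iio mu.ord := fun γ a =>
    if h : ∃ v, ((e a).1.filter (· ∈ Y γ), v) ∈ (e a).2 then h.choose else ⟨0, hpos⟩
  refine ⟨fun γ α => if h : α < mu.ord then F0 γ ⟨α, h⟩ else 0, fun γ α => ?_, fun s v hs => ?_⟩
  · dsimp only
    split_ifs with h
    exacts [(F0 γ ⟨α, h⟩).2, hpos]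
  have hY : ∀ γ ∈ s, ∀ δ ∈ s, γ ≠ δ → ∃ a, ¬ (a ∈ Y γ ↔ a ∈ Y δ) := by
    intro γ hγ δ hδ hne
    by_contra! h
    have h2 : Y γ = Y δ := Set.ext h
    simp only [Y, (hs γ hγ).1, (hs δ hδ).1, dif_pos] at h2
    exact hne (congrArg Subtype.val (X.injective h2))
  have hw : ∀ γ δ, ∃ a : Iio mu.ord, γ ∈ s → δ ∈ s → γ ≠ δ → ¬ (a ∈ Y γ ↔ a ∈ Y δ) := by
    intro γ δ
    by_cases h : γ ∈ s ∧ δ ∈ s ∧ γ ≠ δ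
    · obtain ⟨a, ha⟩ := hY γ h.1 δ h.2.1 h.2.2
      exact ⟨a, fun _ _ _ => ha⟩
    · exact ⟨⟨0, hpos⟩, fun h1 h2 h3 => absurd ⟨h1, h2, h3⟩ h⟩
  choose w hw using hw
  let A : Finset (Iio mu.ord) := (s ×ˢ s).image fun p => w p.1 p.2
  let v' : Ordinal.{u} → Iio mu.ord := fun γ => if h : v γ < mu.ord then ⟨v γ, h⟩ else ⟨0, hpos⟩
  let Φ : Finset (Finset (Iio mu.ord) × Iio mu.ord) :=
    s.image fun γ => (A.filter (· ∈ Y γ), v' γ)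
  refine ⟨e.symm (A, Φ), (e.symm (A, Φ)).2, fun γ hγ => ?_⟩
  have hex : ∃ x, (A.filter (· ∈ Y γ), x) ∈ Φ := ⟨v' γ, Finset.mem_image_of_mem _ hγ⟩
  have hval : F0 γ (e.symm (A, Φ)) = hex.choose := by
    simp only [F0, Equiv.apply_symm_apply, dif_pos hex]
  have hspec := hex.choose_spec
  obtain ⟨δ, hδ, hδe⟩ := Finset.mem_image.1 hspec
  have hγδ : γ = δ := by
    by_contra hne
    refine hw γ δ hγ hδ hne ?_
    have hA : w γ δ ∈ A := Finset.mem_image.2 ⟨(γ, δ), Finset.mem_product.2 ⟨hγ, hδ⟩, rfl⟩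
    have h1 := congrArg (fun p => w γ δ ∈ p.1) hδe
    simp only [Finset.mem_filter, hA, true_and, eq_iff_iff] at h1
    exact h1.symm
  have hlt : (e.symm (A, Φ) : Ordinal.{u}) < mu.ord := (e.symm (A, Φ)).2
  dsimp only
  rw [dif_pos hlt]
  change ((F0 γ (e.symm (A, Φ)) : Iio mu.ord) : Ordinal) = v γ
  have h2 : v' δ = hex.choose := (Prod.ext_iff.1 hδe).2
  rw [hval, ← h2, ← hγδ]
  simp only [v', dif_pos (hs γ hγ).2]

theorem IsPartialFun.insert {ι : Type*} [DecidableEq (ι × Ordinal.{u})]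
    {V : Set (ι × Ordinal.{u})} {s : Finset (ι × Ordinal.{u})} (hs : IsPartialFun V s)
    {x : ι × Ordinal.{u}} (hx : x ∈ V) (h : ∀ y ∈ s, y.1 ≠ x.1) :
    IsPartialFun V (insert x s) := by
  have hx' : IsPartialFun V {x} := by
    refine ⟨by simpa using hx, fun y hy z hz _ => ?_⟩
    rw [Finset.mem_singleton.1 hy, Finset.mem_singleton.1 hz]
  rw [Finset.insert_eq]
  refine hx'.union hs fun y hy z hz hyz => ?_
  rw [Finset.mem_singleton.1 hy] at hyz
  exact absurd hyz.symm (h z hz)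

/-- Finitely many sets, each densely decided by adding only elements satisfying `P`, can be
decided simultaneously. -/
theorem exists_decides_forall {I : Type u} {ι J : Type*} {D : Filter I} {F : ι → I → Ordinal.{u}}
    {V : Set (ι × Ordinal.{u})} (B : J → Set I) (P : ι × Ordinal.{u} → Prop) (s : Finset J)
    (h : ∀ j ∈ s, ∀ q, IsPartialFun V q → ∃ q', IsPartialFun V q' ∧ q ⊆ q' ∧
      (∀ x ∈ q', x ∈ q ∨ P x) ∧ Decides D F q' (B j))
    (q : Finset (ι × Ordinal.{u})) (hq : IsPartialFun V q) :
    ∃ q', IsPartialFun V q' ∧ q ⊆ q' ∧ (∀ x ∈ q', x ∈ q ∨ P x) ∧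
      ∀ j ∈ s, Decides D F q' (B j) := by
  classical
  induction s using Finset.induction_on with
  | empty => exact ⟨q, hq, subset_rfl, fun x hx => Or.inl hx, by simp⟩
  | insert j s _ ih =>
    obtain ⟨q₁, h₁, h₂, h₃, h₄⟩ := ih fun i hi => h i (Finset.mem_insert_of_mem hi)
    obtain ⟨q₂, k₁, k₂, k₃, k₄⟩ := h j (Finset.mem_insert_self j s) q₁ h₁
    refine ⟨q₂, k₁, h₂.trans k₂, fun x hx => (k₃ x hx).elim (h₃ x) Or.inr, fun i hi => ?_⟩
    rcases Finset.mem_insert.1 hi with rfl | hi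
    exacts [k₄, (h₄ i hi).mono k₂]

/-- A condition can be extended by two new values, at `ε` and `ε + 1`, that are distinct from all
values of the condition and that the given functions `h` cannot tell apart. -/
theorem exists_indiscernible_pair {I : Type u} {κ : Type*} {mu : Cardinal.{u}} (hmu : ℵ₀ ≤ mu)
    {D : Filter I} {F : κ ⊕ Ordinal.{u} → I → Ordinal.{u}}
    {V : Set ((κ ⊕ Ordinal.{u}) × Ordinal.{u})} {R : Ordinal.{u} → Ordinal.{u} → Prop}
    (H : Finset (I → Ordinal.{u})) (ε : Ordinal.{u})
    (hV : ∀ β < mu.ord, (Sum.inr ε, β) ∈ V ∧ (Sum.inr (ε + 1), β) ∈ V)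
    (hdec : ∀ h ∈ H, ∀ β < mu.ord, ∀ q, IsPartialFun V q → ∃ q', IsPartialFun V q' ∧ q ⊆ q' ∧
      (∀ x ∈ q', x ∈ q ∨ ∀ γ, x.1 = Sum.inr γ → γ < ε) ∧ Decides D F q' {t | R (h t) β})
    (q : Finset ((κ ⊕ Ordinal.{u}) × Ordinal.{u})) (hq : IsPartialFun V q)
    (hlt : ∀ x ∈ q, ∀ γ, x.1 = Sum.inr γ → γ < ε) :
    ∃ q' β β', IsPartialFun V q' ∧ q ⊆ q' ∧ (Sum.inr ε, β) ∈ q' ∧ (Sum.inr (ε + 1), β') ∈ q' ∧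
      β ≠ β' ∧ (∀ x ∈ q, x.2 ≠ β ∧ x.2 ≠ β') ∧ (∀ x ∈ q', ∀ γ, x.1 = Sum.inr γ → γ < ε + 2) ∧
      ∀ᶠ t in D, t ∈ cylinder F q' → ∀ h ∈ H, (R (h t) β ↔ R (h t) β') := by
  classical
  have hinf : (Iio mu.ord \ ↑(q.image Prod.snd) : Set Ordinal.{u}).Infinite := by
    refine Set.Infinite.sdiff ?_ (Finset.finite_toSet _)
    rw [← Set.infinite_coe_iff, infinite_iff, mk_Iio_ordinal, card_ord]
    exact aleph0_le_lift.2 hmu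
  obtain ⟨C, hC, hcard⟩ := hinf.exists_subset_card_eq (2 ^ H.card + 1)
  obtain ⟨q₁, h₁, h₂, h₃, h₄⟩ := exists_decides_forall
    (fun p : (I → Ordinal.{u}) × Ordinal.{u} => {t | R (p.1 t) p.2})
    (fun x => ∀ γ, x.1 = Sum.inr γ → γ < ε) (H ×ˢ C)
    (fun p hp => hdec p.1 (Finset.mem_product.1 hp).1 p.2 (hC (Finset.mem_product.1 hp).2).1) q hq
  obtain ⟨β, hβ, β', hβ', hne, heq⟩ := Finset.exists_ne_map_eq_of_card_lt_of_maps_to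
    (s := C) (t := H.powerset)
    (f := fun β => H.filter fun h => ∀ᶠ t in D, t ∈ cylinder F q₁ → R (h t) β)
    (by rw [Finset.card_powerset, hcard]; exact Nat.lt_succ_self _)
    (fun β _ => Finset.mem_powerset.2 (Finset.filter_subset _ _))
  have hlt₁ : ∀ x ∈ q₁, ∀ γ, x.1 = Sum.inr γ → γ < ε := fun x hx =>
    (h₃ x hx).elim (hlt x) id
  have hε : ε < ε + 1 := by simp
  have hε2 : ε + 1 < ε + 2 := by
    rw [← one_add_one_eq_two, ← add_assoc]; simp
  have hq₂ : IsPartialFun V (insert (Sum.inr ε, β) q₁) :=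
    h₁.insert (hV β (hC hβ).1).1 fun y hy h => (hlt₁ y hy ε h).false
  have hq₃ : IsPartialFun V (insert (Sum.inr (ε + 1), β') (insert (Sum.inr ε, β) q₁)) := by
    refine hq₂.insert (hV β' (hC hβ').1).2 fun y hy h => ?_
    rcases Finset.mem_insert.1 hy with rfl | hy
    · exact hε.ne (Sum.inr.inj h)
    · exact (hε.trans (hlt₁ y hy _ h)).false
  have hsub : q₁ ⊆ insert (Sum.inr (ε + 1), β') (insert (Sum.inr ε, β) q₁) :=
    (Finset.subset_insert _ _).trans (Finset.subset_insert _ _)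
  refine ⟨_, β, β', hq₃, h₂.trans hsub, by simp, by simp, hne, fun x hx => ?_, fun x hx γ h => ?_,
    ?_⟩
  · exact ⟨fun h => (hC hβ).2 (Finset.mem_coe.2 (Finset.mem_image.2 ⟨x, hx, h⟩)),
      fun h => (hC hβ').2 (Finset.mem_coe.2 (Finset.mem_image.2 ⟨x, hx, h⟩))⟩
  · rcases Finset.mem_insert.1 hx with rfl | hx
    · rw [← Sum.inr.inj h]; exact hε2
    rcases Finset.mem_insert.1 hx with rfl | hx
    · rw [← Sum.inr.inj h]; exact hε.trans hε2
    · exact (hlt₁ x hx γ h).trans (hε.trans hε2)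
  · have hall : ∀ᶠ t in D, ∀ h ∈ H, t ∈ cylinder F q₁ → (R (h t) β ↔ R (h t) β') := by
      refine (Filter.eventually_all_finset H).2 fun h hh => ?_
      have hiff := congrArg (fun u => h ∈ u) heq
      simp only [Finset.mem_filter, hh, true_and, eq_iff_iff] at hiff
      rcases h₄ (h, β) (Finset.mem_product.2 ⟨hh, hβ⟩) with k | k
      · filter_upwards [k, hiff.1 k] with t k₁ k₂ ht using iff_of_true (k₁ ht) (k₂ ht)
      · rcases h₄ (h, β') (Finset.mem_product.2 ⟨hh, hβ'⟩) with k' | k'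
        · filter_upwards [k', hiff.2 k'] with t k₁ k₂ ht using iff_of_true (k₂ ht) (k₁ ht)
        · filter_upwards [k, k'] with t k₁ k₂ ht using iff_of_false (k₁ ht) (k₂ ht)
    exact hall.mono fun t k ht h hh => k h hh (cylinder_anti hsub ht)

/-- The union of the pairs `{2 * δ, 2 * δ + 1}` for `δ ∈ Δ`. -/
def blocks (Δ : Finset Ordinal.{u}) : Set Ordinal.{u} :=
  {γ | ∃ δ ∈ Δ, γ = 2 * δ ∨ γ = 2 * δ + 1}

theorem blocks_insert (δ : Ordinal.{u}) (Δ : Finset Ordinal.{u}) :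
    blocks (insert δ Δ) = insert (2 * δ) (insert (2 * δ + 1) (blocks Δ)) := by
  ext γ
  simp [blocks, or_assoc]

theorem exists_eq_two_mul_or (γ : Ordinal.{u}) : ∃ δ ≤ γ, γ = 2 * δ ∨ γ = 2 * δ + 1 := by
  refine ⟨γ / 2, Ordinal.div_le_of_le_mul (Ordinal.le_mul_right γ two_pos), ?_⟩
  have h := Ordinal.div_add_mod γ 2
  have h2 : γ % 2 < 2 := Ordinal.mod_lt γ two_ne_zero
  rw [← one_add_one_eq_two, ← Order.succ_eq_add_one, Order.lt_succ_iff,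
    Order.le_one_iff, Order.succ_eq_add_one, one_add_one_eq_two] at h2
  rcases h2 with h3 | h3 <;> rw [h3] at h
  · left
    rw [add_zero] at h
    exact h.symm
  · exact Or.inr h.symm

theorem not_evenOrdinal_two_mul_add_one (δ : Ordinal.{u}) : ¬ EvenOrdinal (2 * δ + 1) := by
  rintro ⟨δ', h⟩
  have h2 := congrArg (· % 2) h
  simp only [Ordinal.mul_add_mod_self, Ordinal.mul_mod] at h2
  rw [Ordinal.mod_eq_of_lt one_lt_two] at h2
  exact one_ne_zero h2

/-- A condition without values at ordinals can be extended to one that determines pairwise distinct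
values on `blocks Δ`, such that `h` cannot tell apart the two values in the block of `d h`. -/
theorem exists_extension_blocks {I : Type u} {κ : Type*} {mu : Cardinal.{u}} (hmu : ℵ₀ ≤ mu)
    {D : Filter I} {F : κ ⊕ Ordinal.{u} → I → Ordinal.{u}}
    {V : Set ((κ ⊕ Ordinal.{u}) × Ordinal.{u})} {R : Ordinal.{u} → Ordinal.{u} → Prop}
    {η : Ordinal.{u}} (hη : ∀ δ < η, 2 * δ + 1 < η)
    (hV : ∀ γ < η, ∀ β < mu.ord, (Sum.inr γ, β) ∈ V)
    {H : Finset (I → Ordinal.{u})} {d : (I → Ordinal.{u}) → Ordinal.{u}}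
    (hdec : ∀ h ∈ H, ∀ β < mu.ord, ∀ q, IsPartialFun V q → ∃ q', IsPartialFun V q' ∧ q ⊆ q' ∧
      (∀ x ∈ q', x ∈ q ∨ ∀ γ, x.1 = Sum.inr γ → γ < 2 * d h) ∧ Decides D F q' {t | R (h t) β})
    {p : Finset ((κ ⊕ Ordinal.{u}) × Ordinal.{u})} (hp : IsPartialFun V p)
    (hpl : ∀ x ∈ p, ∀ γ, x.1 ≠ Sum.inr γ) (Δ : Finset Ordinal.{u}) (hΔ : ∀ δ ∈ Δ, δ < η) :
    ∃ q, IsPartialFun V q ∧ p ⊆ q ∧ (∀ γ ∈ blocks Δ, ∃ v, (Sum.inr γ, v) ∈ q) ∧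
      (∀ t ∈ cylinder F q, InjOn (fun γ => F (Sum.inr γ) t) (blocks Δ)) ∧
      (∀ x ∈ q, ∀ γ, x.1 = Sum.inr γ → ∃ δ ∈ Δ, γ < 2 * δ + 2) ∧
      ∀ᶠ t in D, t ∈ cylinder F q → ∀ h ∈ H, d h ∈ Δ →
        (R (h t) (F (Sum.inr (2 * d h)) t) ↔ R (h t) (F (Sum.inr (2 * d h + 1)) t)) := by
  classical
  induction Δ using Finset.induction_on_max with
  | empty =>
    refine ⟨p, hp, subset_rfl, by simp [blocks], by simp [blocks],
      fun x hx γ h => absurd h (hpl x hx γ), by simp⟩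
  | insert δ Δ hmax ih =>
    obtain ⟨q, hq, hpq, hdom, hinj, hlt, hR⟩ := ih fun x hx => hΔ x (Finset.mem_insert_of_mem hx)
    have hδ := hΔ δ (Finset.mem_insert_self _ _)
    have hone : 2 * δ < 2 * δ + 1 := by simp
    obtain ⟨q', β, β', hq', hqq', hβ, hβ', hne, hfresh, hlt', hR'⟩ :=
      exists_indiscernible_pair (F := F) (D := D) (R := R) hmu (H.filter fun h => d h = δ) (2 * δ)
        (fun β hβ => ⟨hV _ (hone.trans (hη δ hδ)) β hβ, hV _ (hη δ hδ) β hβ⟩)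
        (by
          intro h hh
          obtain ⟨hH, rfl⟩ := Finset.mem_filter.1 hh
          exact hdec h hH) q hq (by
        intro x hx γ h
        obtain ⟨δ', h1, h2⟩ := hlt x hx γ h
        refine h2.trans_le ?_
        rw [← Ordinal.mul_succ]
        exact mul_le_mul_right (Order.succ_le_of_lt (hmax δ' h1)) 2)
    refine ⟨q', hq', hpq.trans hqq', ?_, ?_, ?_, ?_⟩
    · rw [blocks_insert]
      rintro γ (rfl | rfl | hγ)
      · exact ⟨β, hβ⟩
      · exact ⟨β', hβ'⟩
      · obtain ⟨v, hv⟩ := hdom γ hγ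
        exact ⟨v, hqq' hv⟩
    · intro t ht
      have hold : ∀ γ ∈ blocks Δ, F (Sum.inr γ) t ≠ β ∧ F (Sum.inr γ) t ≠ β' := by
        intro γ hγ
        obtain ⟨v, hv⟩ := hdom γ hγ
        have := hfresh _ hv
        rwa [← ht _ (hqq' hv)] at this
      have e1 : F (Sum.inr (2 * δ)) t = β := ht _ hβ
      have e2 : F (Sum.inr (2 * δ + 1)) t = β' := ht _ hβ'
      have hinj' := hinj t (cylinder_anti hqq' ht)
      rw [blocks_insert]
      intro γ hγ γ' hγ' h
      dsimp only at h
      rcases hγ with rfl | rfl | hγ <;> rcases hγ' with rfl | rfl | hγ'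
      · rfl
      · exact absurd (e1.symm.trans (h.trans e2)) hne
      · exact absurd (h.symm.trans e1) (hold γ' hγ').1
      · exact absurd (e1.symm.trans (h.symm.trans e2)) hne
      · rfl
      · exact absurd (h.symm.trans e2) (hold γ' hγ').2
      · exact absurd (h.trans e1) (hold γ hγ).1
      · exact absurd (h.trans e2) (hold γ hγ).2
      · exact hinj' hγ hγ' h
    · intro x hx γ h
      exact ⟨δ, Finset.mem_insert_self _ _, hlt' x hx γ h⟩
    · filter_upwards [hR, hR'] with t k k' ht h hh hd
      rcases Finset.mem_insert.1 hd with hd | hd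
      · have e1 : F (Sum.inr (2 * δ)) t = β := ht _ hβ
        have e2 : F (Sum.inr (2 * δ + 1)) t = β' := ht _ hβ'
        rw [hd, e1, e2]
        exact k' ht h (Finset.mem_filter.2 ⟨hh, hd⟩)
      · exact k (cylinder_anti hqq' ht) h hh hd

theorem IsPartialFun.exists_val {ι : Type*} {V : Set (ι × Ordinal.{u})}
    {s : Finset (ι × Ordinal.{u})} (hs : IsPartialFun V s) :
    ∃ v : ι → Ordinal.{u}, ∀ x ∈ s, v x.1 = x.2 := by
  have h : ∀ i, ∃ y, ∀ x ∈ s, x.1 = i → y = x.2 := by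
    intro i
    by_cases h : ∃ x ∈ s, x.1 = i
    · obtain ⟨x, hx, rfl⟩ := h
      exact ⟨x.2, fun z hz hzx => hs.2 x hx z hz hzx.symm⟩
    · exact ⟨0, fun x hx hxi => absurd ⟨x, hx, hxi⟩ h⟩
  choose v hv using h
  exact ⟨v, fun x hx => hv x.1 x hx rfl⟩

theorem NonzeroMod.mono {I : Type u} {D : Filter I} {A B : Set I} (hA : NonzeroMod D A)
    (h : A ⊆ B) : NonzeroMod D B :=
  fun hB => hA (Filter.mem_of_superset hB (compl_subset_compl.2 h))

/-- The admissible values: elements of the range for functions of `G`, and ordinals below `mu` for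
indices below `mu⁺`. -/
def admissible {I : Type u} (mu : Cardinal.{u}) (G : Set (I → Ordinal.{u})) :
    Set (((I → Ordinal.{u}) ⊕ Ordinal.{u}) × Ordinal.{u}) :=
  {x | (∀ g, x.1 = Sum.inl g → g ∈ G ∧ x.2 ∈ range g) ∧
    ∀ γ, x.1 = Sum.inr γ → γ < (Order.succ mu).ord ∧ x.2 < mu.ord}

/-- Composing independent functions with `gstar` gives functions jointly independent of `G`. -/
theorem nonzeroMod_cylinder_comp {I : Type u} {mu : Cardinal.{u}} {D : Filter I}
    {G : Set (I → Ordinal.{u})} {gstar : I → Ordinal.{u}} (hgs : gstar ∉ G)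
    (hind : IndependentMod D (insert gstar G)) (hrange : range gstar = Iio mu.ord)
    {F : Ordinal.{u} → Ordinal.{u} → Ordinal.{u}}
    (hF : ∀ (s : Finset Ordinal.{u}) (v : Ordinal.{u} → Ordinal.{u}),
      (∀ γ ∈ s, γ < (Order.succ mu).ord ∧ v γ < mu.ord) → ∃ α < mu.ord, ∀ γ ∈ s, F γ α = v γ)
    (s : Finset (((I → Ordinal.{u}) ⊕ Ordinal.{u}) × Ordinal.{u}))
    (hs : IsPartialFun (admissible mu G) s) :
    NonzeroMod D (cylinder (Sum.elim id fun γ t => F γ (gstar t)) s) := by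
  classical
  obtain ⟨v, hv⟩ := hs.exists_val
  have hmem : ∀ i ∈ s.image Prod.fst, (i, v i) ∈ s := by
    intro i hi
    obtain ⟨x, hx, rfl⟩ := Finset.mem_image.1 hi
    rwa [hv x hx]
  obtain ⟨α, hα, hαF⟩ := hF (s.image Prod.fst).toRight (fun γ => v (Sum.inr γ)) fun γ hγ =>
    (hs.1 (hmem _ (Finset.mem_toRight.1 hγ))).2 γ rfl
  have hleft : ∀ g ∈ (s.image Prod.fst).toLeft, g ∈ G ∧ v (Sum.inl g) ∈ range g := fun g hg =>
    (hs.1 (hmem _ (Finset.mem_toLeft.1 hg))).1 g rfl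
  let p : PartialAssignment I (insert gstar G) :=
    { dom := insert gstar (s.image Prod.fst).toLeft
      dom_sub := by
        rw [Finset.coe_insert]
        exact insert_subset_insert fun g hg => (hleft g hg).1
      val := fun g => if g = gstar then α else v (Sum.inl g)
      val_mem := by
        intro g hg
        split_ifs with h
        · rw [h, hrange]
          exact hα
        · exact (hleft g (Finset.mem_of_mem_insert_of_ne hg h)).2 }
  refine (hind p).mono fun t ht x hx => ?_
  have hx1 : x.1 ∈ s.image Prod.fst := Finset.mem_image_of_mem _ hx
  rw [← hv x hx]
  have hstar : gstar t = α := (ht gstar (Finset.mem_insert_self _ _)).trans (if_pos rfl)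
  rcases hi : x.1 with g | γ <;> rw [hi] at hx1
  · have hg := Finset.mem_toLeft.2 hx1
    refine (ht g (Finset.mem_insert_of_mem hg)).trans (if_neg ?_)
    rintro rfl
    exact hgs (hleft _ hg).1
  · change F γ (gstar t) = _
    rw [hstar]
    exact hαF γ (Finset.mem_toRight.2 hx1)

/-- If the functions `f γ` are jointly independent of `G`, then, keeping `G` independent, one can
make them pairwise distinct, with every `h` unable to tell apart some `f (2 * δ)` and
`f (2 * δ + 1)`. -/
theorem exists_pairwise_distinct_indiscernible {I : Type u} {mu : Cardinal.{u}} (hmu : ℵ₀ ≤ mu)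
    {D₀ : Filter I} {G : Set (I → Ordinal.{u})} (hG : ∀ g ∈ G, ∀ t, g t < mu.ord)
    {f : Ordinal.{u} → I → Ordinal.{u}}
    (hpos : ∀ s, IsPartialFun (admissible mu G) s → NonzeroMod D₀ (cylinder (Sum.elim id f) s))
    (R : Ordinal.{u} → Ordinal.{u} → Prop) :
    ∃ D ≤ D₀, IndependentMod D G ∧
      (∀ h : I → Ordinal.{u}, ∃ δ, 2 * δ + 1 < (Order.succ mu).ord ∧
        ∀ᶠ t in D, R (h t) (f (2 * δ) t) ↔ R (h t) (f (2 * δ + 1) t)) ∧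
      ∀ E : Finset Ordinal.{u}, ↑E ⊆ Iio (Order.succ mu).ord →
        ∀ᶠ t in D, InjOn (fun γ => f γ t) ↑E := by
  classical
  set η := (Order.succ mu).ord
  have hη2 : ∀ δ < η, 2 * δ + 1 < η := by
    have hlim : Order.IsSuccLimit η := isSuccLimit_ord (hmu.trans (Order.le_succ mu))
    have hprin : Ordinal.IsPrincipal (· * ·) η :=
      Ordinal.isPrincipal_mul_ord (hmu.trans (Order.le_succ mu))
    have h2 : (2 : Ordinal.{u}) < η :=
      (Ordinal.natCast_lt_omega0 2).trans_le ((Cardinal.ord_aleph0 ▸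
        Cardinal.ord_le_ord.2 (hmu.trans (Order.le_succ mu)) :))
    intro δ hδ
    exact hlim.succ_lt (hprin h2 hδ)
  obtain ⟨D', hD', hpos', hmax⟩ := exists_maximal_filter
    {A | ∃ s, IsPartialFun (admissible mu G) s ∧ A = cylinder (Sum.elim id f) s} D₀ (by
      rintro _ ⟨s, hs, rfl⟩
      exact hpos s hs)
  have hpos₁ : ∀ s, IsPartialFun (admissible mu G) s →
      NonzeroMod D' (cylinder (Sum.elim id f) s) := fun s hs => hpos' _ ⟨s, hs, rfl⟩
  have hdec := exists_decides hpos₁ (fun D'' hle h => hmax D'' hle (by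
    rintro _ ⟨s, hs, rfl⟩
    exact h s hs))
  have hVlt : ∀ x ∈ admissible mu G, x.2 < mu.ord := by
    rintro ⟨i | i, y⟩ hx
    · obtain ⟨h1, t, h2⟩ := hx.1 i rfl
      exact h2 ▸ hG i h1 t
    · exact (hx.2 i rfl).2
  have hd : ∀ h : I → Ordinal.{u}, ∃ δ < η, ∀ β < mu.ord, ∀ q, IsPartialFun (admissible mu G) q →
      ∃ q', IsPartialFun (admissible mu G) q' ∧ q ⊆ q' ∧
      (∀ x ∈ q', x ∈ q ∨ ∀ γ, x.1 = Sum.inr γ → γ < 2 * δ) ∧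
      Decides D' (Sum.elim id f) q' {t | R (h t) β} := by
    intro h
    obtain ⟨T, hT, hTdec⟩ := exists_support hmu hVlt hdec fun β => {t | R (h t) β}
    obtain ⟨δ, hδ, hbd⟩ := exists_bound_lt_succ_ord hmu T hT (Sum.elim (fun _ => 0) id)
    refine ⟨δ, hδ, fun β hβ q hq => ?_⟩
    obtain ⟨q', h1, h2, h3, h4⟩ := hTdec β hβ q hq
    refine ⟨q', h1, h2, fun x hx => (h3 x hx).imp_right fun hxT γ hγ => ?_, h4⟩
    have h5 := hbd x hxT
    rw [hγ] at h5
    exact (h5 ((h1.1 hx).2 γ hγ).1).trans_le (Ordinal.le_mul_right δ two_pos)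
  choose d hdη hd using hd
  let S : Finset (I → Ordinal.{u}) × Finset Ordinal.{u} → Set I := fun P =>
    {t | (∀ h ∈ P.1, R (h t) (f (2 * d h) t) ↔ R (h t) (f (2 * d h + 1) t)) ∧
      InjOn (fun γ => f γ t) {γ | γ ∈ P.2 ∧ γ < η}}
  have hS : Antitone S := fun P Q hPQ t ht =>
    ⟨fun h hh => ht.1 h (hPQ.1 hh), ht.2.mono fun γ hγ => (⟨hPQ.2 hγ.1, hγ.2⟩ :
      γ ∈ Q.2 ∧ γ < η)⟩
  have hSD : ∀ P, S P ∈ ⨅ P, D' ⊓ Filter.principal (S P) := fun P =>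
    Filter.mem_iInf_of_mem P (Filter.mem_inf_of_right (Filter.mem_principal_self _))
  refine ⟨⨅ P, D' ⊓ Filter.principal (S P), (iInf_le _ (∅, ∅)).trans (inf_le_left.trans hD'),
    fun p hp => ?_, fun h => ⟨d h, hη2 _ (hdη h), ?_⟩, fun E hE => ?_⟩
  · rw [Filter.mem_iInf_of_directed] at hp
    swap
    · exact Antitone.directed_ge fun P Q hPQ =>
        inf_le_inf_left _ (Filter.principal_mono.2 (hS hPQ))
    obtain ⟨⟨H, E⟩, hp⟩ := hp
    rw [Filter.mem_inf_principal] at hp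
    choose b hb hb' using exists_eq_two_mul_or.{u}
    have hs : IsPartialFun (admissible mu G)
        (p.dom.image fun g => ((Sum.inl g : (I → Ordinal.{u}) ⊕ Ordinal.{u}), p.val g)) := by
      refine ⟨fun x hx => ?_, fun x hx y hy hxy => ?_⟩
      · obtain ⟨g, hg, rfl⟩ := Finset.mem_image.1 (Finset.mem_coe.1 hx)
        refine ⟨fun g' hg' => ?_, fun γ hγ => by simp at hγ⟩
        obtain rfl := Sum.inl.inj hg'
        exact ⟨p.dom_sub hg, p.val_mem g hg⟩
      · obtain ⟨g, hg, rfl⟩ := Finset.mem_image.1 hx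
        obtain ⟨g', hg', rfl⟩ := Finset.mem_image.1 hy
        rw [Sum.inl.inj hxy]
    obtain ⟨q, hq, hpq, -, hinj, -, hind⟩ := exists_extension_blocks hmu hη2
      (F := Sum.elim id f) (V := admissible mu G) (R := R)
      (fun γ hγ β hβ => ⟨fun g hg => by simp at hg, fun γ' hγ' => Sum.inr.inj hγ' ▸ ⟨hγ, hβ⟩⟩)
      (H := H) (fun h _ => hd h) hs
      (by
        intro x hx γ h
        obtain ⟨g, hg, rfl⟩ := Finset.mem_image.1 hx
        simp at h)
      (H.image d ∪ (E.filter (· < η)).image b) (by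
        intro δ hδ
        rcases Finset.mem_union.1 hδ with hδ | hδ
        · obtain ⟨h, -, rfl⟩ := Finset.mem_image.1 hδ
          exact hdη h
        · obtain ⟨γ, hγ, rfl⟩ := Finset.mem_image.1 hδ
          exact (hb γ).trans_lt (Finset.mem_filter.1 hγ).2)
    refine hpos₁ q hq ?_
    filter_upwards [hp, hind] with t hpt ht htq
    refine hpt ⟨fun h hh => ?_, (hinj t htq).mono fun γ hγ => ?_⟩ fun g hg => ?_
    · exact ht htq h hh (Finset.mem_union_left _ (Finset.mem_image_of_mem d hh))
    · exact ⟨b γ, Finset.mem_union_right _ (Finset.mem_image_of_mem b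
        (Finset.mem_filter.2 hγ)), hb' γ⟩
    · exact htq (Sum.inl g, p.val g) (hpq (Finset.mem_image_of_mem _ hg))
  · filter_upwards [hSD ({h}, ∅)] with t ht using ht.1 h (Finset.mem_singleton_self h)
  · filter_upwards [hSD (∅, E)] with t ht using ht.2.mono fun γ hγ => (⟨hγ, hE hγ⟩ :
      γ ∈ E ∧ γ < η)

/-- Every filter keeping `G` independent extends to one that makes a good triple. -/
theorem exists_isGoodTriple {I : Type u} {lam mu : Cardinal.{u}} {D : Filter I}
    {G : Set (I → Ordinal.{u})} (h : IsPreGoodTriple lam mu D G) :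
    ∃ D' ≤ D, IsGoodTriple lam mu D' G := by
  obtain ⟨hI, ⟨X, hX, hfin⟩, hG, hind⟩ := h
  obtain ⟨D', hle, hpos, hmax⟩ := exists_maximal_filter (range PartialAssignment.Aset) D (by
    rintro _ ⟨p, rfl⟩
    exact hind p)
  refine ⟨D', hle, ⟨hI, ⟨X, fun i hi => hle (hX i hi), hfin⟩, hG, fun p => hpos _ ⟨p, rfl⟩⟩,
    fun E hsub hE => hmax E hsub ?_⟩
  rintro _ ⟨p, rfl⟩
  exact hE p

/-- at the cost of one independent function `g*` one can extend `D₀` to a filter `D`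
keeping `(I, D, G)` a `(lam, mu)`-good triple, together with a `mu⁺`-sequence of functions to `mu`
which are pairwise distinct modulo, and `R`-indiscernible-omitting for, every ultrafilter
`D* ⊇ D`; so no such `D*` saturates the random graph. -/
theorem omitting_random_graph_type {I : Type u} (lam mu : Cardinal.{u})
    (hmu : ℵ₀ ≤ mu) (hml : mu ≤ lam) (hsucc : Order.succ mu < lam)
    (D₀ : Filter I) (G : Set (I → Ordinal.{u}))
    (gstar : I → Ordinal.{u}) (hgs : gstar ∉ G)
    (htriple : IsGoodTriple lam mu D₀ (insert gstar G))
    (hrange : Set.range gstar = Set.Iio mu.ord)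
    (R : Ordinal.{u} → Ordinal.{u} → Prop) (hR : IsRandomGraphOn mu R) :
    ∃ D : Filter I, (∀ A ∈ D₀, A ∈ D) ∧ IsGoodTriple lam mu D G ∧
      ∃ f : Ordinal.{u} → I → Ordinal.{u},
        (∀ γ, γ < (Order.succ mu).ord → ∀ t : I, f γ t < mu.ord) ∧
        ∀ Dstar : Ultrafilter I, (∀ A ∈ D, A ∈ Dstar) →
          (∀ γ δ : Ordinal.{u}, γ < δ → δ < (Order.succ mu).ord →
            {t : I | f γ t = f δ t} ∉ Dstar) ∧
          (∀ uu : Finset Ordinal.{u}, ↑uu ⊆ Set.Iio (Order.succ mu).ord →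
            ∃ h : I → Ordinal.{u}, (∀ t : I, h t < mu.ord) ∧
              ∀ γ ∈ uu, ({t : I | R (h t) (f γ t)} ∈ Dstar ↔ EvenOrdinal γ)) ∧
          ¬ ∃ h : I → Ordinal.{u}, (∀ t : I, h t < mu.ord) ∧
              ∀ γ, γ < (Order.succ mu).ord →
                ({t : I | R (h t) (f γ t)} ∈ Dstar ↔ EvenOrdinal γ) := by
  classical
  obtain ⟨⟨hI, ⟨X, hX, hfin⟩, hG, hind⟩, -⟩ := htriple
  obtain ⟨F, hFlt, hF⟩ := exists_independent_functions hmu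
  obtain ⟨D₁, hD₁, hind₁, hindisc, hinj⟩ := exists_pairwise_distinct_indiscernible hmu
    (fun g hg => hG g (mem_insert_of_mem _ hg))
    (nonzeroMod_cylinder_comp hgs hind hrange hF) R
  obtain ⟨D, hD, hgood⟩ := exists_isGoodTriple (lam := lam) (mu := mu) (D := D₁) (G := G)
    ⟨hI, ⟨X, fun i hi => hD₁ (hX i hi), hfin⟩, fun g hg => hG g (mem_insert_of_mem _ hg), hind₁⟩
  refine ⟨D, fun A hA => hD (hD₁ hA), hgood, fun γ t => F γ (gstar t),
    fun γ _ t => hFlt γ _, fun Dstar hDstar => ?_⟩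
  have hle : (Dstar : Filter I) ≤ D₁ := fun A hA => hDstar A (hD hA)
  refine ⟨fun γ δ hlt hδ hmem => ?_, fun uu huu => ?_, ?_⟩
  · have h1 := Filter.Eventually.filter_mono hle (hinj {γ, δ} (by
      intro x hx
      rcases Finset.mem_insert.1 (Finset.mem_coe.1 hx) with rfl | hx
      · exact hlt.trans hδ
      · rw [Finset.mem_singleton.1 hx]
        exact hδ))
    obtain ⟨t, ht1, ht2⟩ := (h1.and hmem).exists
    exact hlt.ne (ht1 (by simp) (by simp) ht2)
  · have hx : ∀ t, ∃ x < mu.ord, InjOn (fun γ => F γ (gstar t)) uu →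
        ∀ γ ∈ uu, (R x (F γ (gstar t)) ↔ EvenOrdinal γ) := by
      intro t
      by_cases hi : InjOn (fun γ => F γ (gstar t)) uu
      · obtain ⟨x, hx, hx1, hx2⟩ := hR.2.2
          ((uu.filter EvenOrdinal).image fun γ => F γ (gstar t))
          ((uu.filter fun γ => ¬ EvenOrdinal γ).image fun γ => F γ (gstar t))
          (by
            intro y hy
            obtain ⟨γ, -, rfl⟩ := Finset.mem_image.1 (Finset.mem_coe.1 hy)
            exact hFlt _ _)
          (by
            intro y hy
            obtain ⟨γ, -, rfl⟩ := Finset.mem_image.1 (Finset.mem_coe.1 hy)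
            exact hFlt _ _)
          (by
            rw [Finset.disjoint_left]
            intro y hy hy'
            obtain ⟨γ, hγ, rfl⟩ := Finset.mem_image.1 hy
            obtain ⟨γ', hγ', he⟩ := Finset.mem_image.1 hy'
            rw [Finset.mem_filter] at hγ hγ'
            exact hγ'.2 (hi hγ'.1 hγ.1 he ▸ hγ.2))
        refine ⟨x, hx, fun _ γ hγ => ⟨fun hr => ?_, fun he => ?_⟩⟩
        · by_contra hne
          exact hx2 _ (Finset.mem_image_of_mem _ (Finset.mem_filter.2 ⟨hγ, hne⟩)) hr
        · exact hx1 _ (Finset.mem_image_of_mem _ (Finset.mem_filter.2 ⟨hγ, he⟩))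
      · exact ⟨0, (isSuccLimit_ord hmu).bot_lt, fun h => absurd h hi⟩
    choose h hlt hh using hx
    have hev := Filter.Eventually.filter_mono hle (hinj uu huu)
    refine ⟨h, hlt, fun γ hγ => ⟨fun hmem => ?_, fun he => ?_⟩⟩
    · obtain ⟨t, ht1, ht2⟩ := (hev.and hmem).exists
      exact (hh t ht1 γ hγ).1 ht2
    · exact hev.mono fun t ht => (hh t ht γ hγ).2 he
  · rintro ⟨h, -, hh⟩
    obtain ⟨δ, hδ, hev⟩ := hindisc h
    have hone : 2 * δ < 2 * δ + 1 := by simp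
    refine not_evenOrdinal_two_mul_add_one δ ((hh _ hδ).1 ?_)
    filter_upwards [hev.filter_mono hle, (hh _ (hone.trans hδ)).2 ⟨δ, rfl⟩] with t ht ht'
      using ht.1 ht'
end

section
/- Let λ ≥ ℵ₂ and let M be a countable model of the random graph with edge relation R. Then there is a λ-regular ultrafilter D* on λ such that: (1) for every family S of D*-nonstandard functions λ → ℕ with |S| ≤ λ there is a D*-nonstandard function g : λ → ℕ with g <_{D*} f for every f ∈ S (so lcf(ℵ₀, D*) ≥ λ⁺); and (2) there is a sequence ⟨f_γ : γ < ℵ₁⟩ of functions λ → M with {t : f_γ(t) = f_δ(t)} ∉ D* for all γ < δ < ℵ₁, such that for every finite u ⊆ ℵ₁ there is h : λ → M with ({t : h(t) R f_γ(t)} ∈ D* if and only if γ is even) for all γ ∈ u, but there is no h : λ → M with ({t : h(t) R f_γ(t)} ∈ D* if and only if γ is even) for all γ < ℵ₁. In particular M^λ/D* is not ℵ₂-saturated, so D* does not saturate the theory of the random graph. -/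
open Cardinal Set

universe u

open Filter Topology Function

section Product

variable {K : Type u}

theorem dense_interior_inter {X : Type*} [TopologicalSpace X] {S T : Set X}
    (hS : Dense (interior S)) (hT : Dense (interior T)) : Dense (interior (S ∩ T)) := by
  rw [interior_inter]
  exact hS.inter_of_isOpen_left hT isOpen_interior

theorem continuous_update_left [DecidableEq K] (k : K) (n : ℕ) :
    Continuous fun x : K → ℕ => update x k n :=
  continuous_id.update k continuous_const

theorem dense_preimage_update [DecidableEq K] {O : Set (K → ℕ)} (hd : Dense O) (k : K) (n : ℕ) :
    Dense ((fun x : K → ℕ => update x k n) ⁻¹' O) := by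
  rw [dense_iff_inter_open]
  rintro N hN ⟨x, hx⟩
  have h1 : IsOpen ((fun w : K → ℕ => update w k (x k)) ⁻¹' N ∩ (fun w => w k) ⁻¹' {n}) :=
    (hN.preimage (continuous_update_left k (x k))).inter
      ((isOpen_discrete _).preimage (continuous_apply k))
  obtain ⟨w, ⟨hw1, hw2⟩, hw3⟩ := hd.inter_open_nonempty _ h1 ⟨update x k n, by simpa using hx⟩
  refine ⟨update w k (x k), hw1, ?_⟩
  have hw2 : w k = n := hw2
  simpa [← hw2] using hw3

theorem dense_interior_preimage_update [DecidableEq K] {S : Set (K → ℕ)} (hS : Dense (interior S))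
    (k : K) (n : ℕ) : Dense (interior ((fun x : K → ℕ => update x k n) ⁻¹' S)) :=
  (dense_preimage_update hS k n).mono
    (interior_maximal (preimage_mono interior_subset)
      (isOpen_interior.preimage (continuous_update_left k n)))

/-- A dense open set contains a dense set of points all of whose modifications on a given finite
set of coordinates, with bounded values, stay in the set. -/
theorem exists_dense_open_forall_modification [DecidableEq K] (s : Finset K) (N : ℕ) {O : Set (K → ℕ)}
    (hO : Dense (interior O)) :
    ∃ O' : Set (K → ℕ), Dense (interior O') ∧ ∀ x ∈ O', ∀ y : K → ℕ,
      (∀ k ∉ s, y k = x k) → (∀ k ∈ s, y k < N) → y ∈ O := by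
  classical
  induction s using Finset.induction_on with
  | empty =>
    refine ⟨O, hO, fun x hx y hy _ => ?_⟩
    rwa [show y = x from funext fun k => hy k (by simp)]
  | insert k s hk ih =>
    obtain ⟨O', hd, h⟩ := ih
    have key : ∀ M : ℕ, Dense (interior {x : K → ℕ | ∀ n < M, update x k n ∈ O'}) := by
      intro M
      induction M with
      | zero => simp
      | succ M ihM =>
        refine (dense_interior_inter ihM (dense_interior_preimage_update hd k M)).mono
          (interior_mono ?_)
        rintro x ⟨h1, h2⟩ n hn
        rcases Nat.lt_succ_iff_lt_or_eq.1 hn with hn | rfl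
        exacts [h1 n hn, h2]
    refine ⟨_, key N, fun x hx y hy hyN => ?_⟩
    refine h _ (hx (y k) (hyN k (by simp))) y (fun j hj => ?_) fun j hj => hyN j (by simp [hj])
    by_cases hjk : j = k
    · simp [hjk]
    · rw [update_of_ne hjk]
      exact hy j (by simp [hjk, hj])

theorem dense_interior_diagonal {Q : ℕ → Set (K → ℕ)} (hQ : ∀ n, Dense (interior (Q n)))
    (k : K) : Dense (interior {x : K → ℕ | x ∈ Q (x k)}) := by
  rw [dense_iff_inter_open]
  rintro N hN ⟨x, hx⟩
  have hk : IsOpen ((fun w : K → ℕ => w k) ⁻¹' {x k}) :=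
    (isOpen_discrete _).preimage (continuous_apply k)
  obtain ⟨w, ⟨hw1, hw2⟩, hw3⟩ := (hQ (x k)).inter_open_nonempty _ (hN.inter hk) ⟨x, hx, rfl⟩
  refine ⟨w, hw1, mem_interior.2 ⟨interior (Q (x k)) ∩ (fun w => w k) ⁻¹' {x k}, ?_,
    isOpen_interior.inter hk, hw3, hw2⟩⟩
  rintro y ⟨hy1, hy2⟩
  have hy2 : y k = x k := hy2
  simpa [hy2] using interior_subset hy1

/-- The points of `U` that remain in `U` whatever their coordinates outside `C` are changed to. -/
def coordCore (C : Set K) (U : Set (K → ℕ)) : Set (K → ℕ) :=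
  {x | ∀ z : K → ℕ, (∀ k ∈ C, z k = x k) → z ∈ U}

theorem coordCore_subset (C : Set K) (U : Set (K → ℕ)) : coordCore C U ⊆ U :=
  fun x hx => hx x fun _ _ => rfl

theorem mem_coordCore_congr {C : Set K} {U : Set (K → ℕ)} {x y : K → ℕ}
    (h : ∀ k ∈ C, x k = y k) : x ∈ coordCore C U ↔ y ∈ coordCore C U :=
  ⟨fun hx z hz => hx z fun k hk => (hz k hk).trans (h k hk).symm,
    fun hy z hz => hy z fun k hk => (hz k hk).trans (h k hk)⟩

theorem exists_countable_closed (e : Finset (K × ℕ) → Finset (K × ℕ)) :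
    ∃ C : Set K, C.Countable ∧
      ∀ c : Finset (K × ℕ), (∀ p ∈ c, p.1 ∈ C) → ∀ p ∈ e c, p.1 ∈ C := by
  classical
  let step : Set K → Set K := fun C =>
    C ∪ ⋃ c ∈ {c : Finset (K × ℕ) | (c : Set (K × ℕ)) ⊆ C ×ˢ Set.univ}, Prod.fst '' (e c : Set (K × ℕ))
  let C : ℕ → Set K := fun n => step^[n] ∅
  have hsucc : ∀ n, C (n + 1) = step (C n) := fun n => iterate_succ_apply' step n ∅
  have hmono : Monotone C := monotone_nat_of_le_succ fun n => by
    rw [hsucc]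
    exact subset_union_left
  have hcount : ∀ n, (C n).Countable := by
    intro n
    induction n with
    | zero => exact countable_empty
    | succ n ih =>
      rw [hsucc]
      refine ih.union (Countable.biUnion ?_ fun c _ => ((e c).finite_toSet.image _).countable)
      have h1 := countable_ofPred_finite_subset (ih.prod (Set.countable_univ (α := ℕ)))
      refine (h1.preimage Finset.coe_injective).mono fun c hc => ?_
      exact ⟨c.finite_toSet, hc⟩
  refine ⟨⋃ n, C n, countable_iUnion hcount, fun c hc p hp => ?_⟩
  choose! N hN using fun p hp => mem_iUnion.1 (hc p hp)
  have hn : (c : Set (K × ℕ)) ⊆ C (c.sup N) ×ˢ Set.univ := fun q hq =>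
    ⟨hmono (Finset.le_sup hq) (hN q hq), trivial⟩
  refine mem_iUnion.2 ⟨c.sup N + 1, ?_⟩
  rw [hsucc]
  exact Or.inr (mem_iUnion₂.2 ⟨c, hn, p, hp, rfl⟩)

/-- The cylinder determined by finitely many coordinate requirements. -/
def cyl (c : Finset (K × ℕ)) : Set (K → ℕ) := {x | ∀ p ∈ c, x p.1 = p.2}

theorem isOpen_cyl (c : Finset (K × ℕ)) : IsOpen (cyl c) := by
  have : cyl c = ⋂ p ∈ c, (fun x : K → ℕ => x p.1) ⁻¹' {p.2} := by
    ext x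
    simp [cyl]
  rw [this]
  exact isOpen_biInter_finset fun p _ => (isOpen_discrete _).preimage (continuous_apply p.1)

theorem exists_cyl_subset {N : Set (K → ℕ)} (hN : IsOpen N) {x : K → ℕ} (hx : x ∈ N) :
    ∃ s : Finset K, cyl (s.map ⟨fun k => (k, x k), fun _ _ h => (Prod.ext_iff.1 h).1⟩) ⊆ N := by
  obtain ⟨s, v, hv, hsub⟩ := isOpen_pi_iff.1 hN x hx
  refine ⟨s, fun y hy => hsub fun k hk => ?_⟩
  have : y k = x k := hy (k, x k) (Finset.mem_map.2 ⟨k, hk, rfl⟩)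
  rw [this]
  exact (hv k hk).2

/-- If the union of two open sets is dense, then countably many coordinates suffice to decide,
on a dense open set, membership in one of them. -/
theorem exists_countable_coordCore [DecidableEq K] {U V : Set (K → ℕ)} (hU : IsOpen U) (hV : IsOpen V)
    (hd : Dense (U ∪ V)) :
    ∃ C : Set K, C.Countable ∧ Dense (interior (coordCore C U ∪ coordCore C V)) := by
  have hext : ∀ c : Finset (K × ℕ), (cyl c).Nonempty →
      ∃ e : Finset (K × ℕ), (cyl (c ∪ e)).Nonempty ∧ (cyl e ⊆ U ∨ cyl e ⊆ V) := by
    intro c hc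
    obtain ⟨x, hxc, hx⟩ := hd.inter_open_nonempty _ (isOpen_cyl c) hc
    have main : ∀ W : Set (K → ℕ), IsOpen W → x ∈ W →
        ∃ e : Finset (K × ℕ), (cyl (c ∪ e)).Nonempty ∧ cyl e ⊆ W := by
      intro W hW hxW
      obtain ⟨s, hs⟩ := exists_cyl_subset hW hxW
      refine ⟨_, ⟨x, fun p hp => ?_⟩, hs⟩
      rcases Finset.mem_union.1 hp with hp | hp
      · exact hxc p hp
      · obtain ⟨k, _, rfl⟩ := Finset.mem_map.1 hp
        rfl
    rcases hx with hx | hx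
    · obtain ⟨e, he, h⟩ := main U hU hx
      exact ⟨e, he, Or.inl h⟩
    · obtain ⟨e, he, h⟩ := main V hV hx
      exact ⟨e, he, Or.inr h⟩
  choose! e he1 he2 using hext
  obtain ⟨C, hC, hclosed⟩ := exists_countable_closed e
  refine ⟨C, hC, ?_⟩
  classical
  rw [dense_iff_inter_open]
  rintro N hN ⟨x, hx⟩
  obtain ⟨s, hs⟩ := exists_cyl_subset hN hx
  let c : Finset (K × ℕ) :=
    (s.filter (· ∈ C)).map ⟨fun k => (k, x k), fun _ _ h => (Prod.ext_iff.1 h).1⟩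
  have hcC : ∀ p ∈ c, p.1 ∈ C := by
    intro p hp
    obtain ⟨k, hk, rfl⟩ := Finset.mem_map.1 hp
    exact (Finset.mem_filter.1 hk).2
  have hc : (cyl c).Nonempty := by
    refine ⟨x, fun p hp => ?_⟩
    obtain ⟨k, _, rfl⟩ := Finset.mem_map.1 hp
    rfl
  obtain ⟨y, hy⟩ := he1 c hc
  have hz : C.piecewise y x ∈ cyl (e c) := fun p hp => by
    rw [piecewise_eq_of_mem _ _ _ (hclosed c hcC p hp)]
    exact hy p (Finset.mem_union_right _ hp)
  refine ⟨C.piecewise y x, hs fun p hp => ?_, mem_interior.2 ⟨cyl (e c), ?_, isOpen_cyl _, hz⟩⟩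
  · obtain ⟨k, hk, rfl⟩ := Finset.mem_map.1 hp
    by_cases hkC : k ∈ C
    · exact (piecewise_eq_of_mem _ _ _ hkC).trans <| hy (k, x k) (Finset.mem_union_left _
        (Finset.mem_map.2 ⟨k, Finset.mem_filter.2 ⟨hk, hkC⟩, rfl⟩))
    · exact piecewise_eq_of_notMem _ _ _ hkC
  · have hcore : ∀ w ∈ cyl (e c), ∀ z : K → ℕ, (∀ k ∈ C, z k = w k) → z ∈ cyl (e c) :=
      fun w hw z hz p hp => (hz p.1 (hclosed c hcC p hp)).trans (hw p hp)
    exact fun w hw => (he2 c hc).imp (fun h z hz => h (hcore w hw z hz))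
      fun h z hz => h (hcore w hw z hz)

end Product
section Trace

variable {I X : Type*} [TopologicalSpace X]

theorem mem_comap_nhds_inf_iff {G : I → X} {D : Filter I} {A : Set I} {x : X} :
    A ∈ comap G (𝓝 x) ⊓ D ↔ ∃ N : Set X, IsOpen N ∧ x ∈ N ∧ (G ⁻¹' N)ᶜ ∪ A ∈ D := by
  constructor
  · intro h
    obtain ⟨s, ⟨t, ht, hts⟩, d, hd, rfl⟩ := mem_inf_iff.1 h
    obtain ⟨N, hN, ho, hx⟩ := mem_nhds_iff.1 ht
    refine ⟨N, ho, hx, mem_of_superset hd fun i hi => ?_⟩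
    by_cases hiN : G i ∈ N
    · exact Or.inr ⟨hts (hN hiN), hi⟩
    · exact Or.inl hiN
  · rintro ⟨N, ho, hx, hd⟩
    refine mem_of_superset (inter_mem_inf (preimage_mem_comap (ho.mem_nhds hx)) hd) ?_
    rintro i ⟨hi, hi' | hi'⟩
    exacts [absurd hi hi', hi']

theorem isOpen_setOf_mem_comap_nhds_inf (G : I → X) (D : Filter I) (A : Set I) :
    IsOpen {x | A ∈ comap G (𝓝 x) ⊓ D} := by
  rw [isOpen_iff_forall_mem_open]
  intro x hx
  obtain ⟨N, ho, hxN, hN⟩ := mem_comap_nhds_inf_iff.1 hx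
  exact ⟨N, fun y hy => mem_comap_nhds_inf_iff.2 ⟨N, ho, hy, hN⟩, ho, hxN⟩

theorem not_mem_comap_nhds_inf_compl {G : I → X} {D : Filter I} {A : Set I} {x : X}
    [NeBot (comap G (𝓝 x) ⊓ D)] (h : A ∈ comap G (𝓝 x) ⊓ D) : Aᶜ ∉ comap G (𝓝 x) ⊓ D :=
  fun h' => by simpa using inter_mem h h'

theorem exists_maximal_filter_comap_nhds_inf_neBot (G : I → X) (D₁ : Filter I)
    (h₁ : ∀ x, NeBot (comap G (𝓝 x) ⊓ D₁)) :
    ∃ D ≤ D₁, (∀ x, NeBot (comap G (𝓝 x) ⊓ D)) ∧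
      ∀ D' ≤ D, (∀ x, NeBot (comap G (𝓝 x) ⊓ D')) → D' = D := by
  obtain ⟨D, hD, hmax⟩ := zorn_le_nonempty₀ (α := (Filter I)ᵒᵈ)
    {D | ∀ x, NeBot (comap G (𝓝 x) ⊓ OrderDual.ofDual D)} (fun c hc hchain y hy => by
      refine ⟨OrderDual.toDual (⨅ D : c, OrderDual.ofDual D.1), fun x => ?_, fun D hD => ?_⟩
      swap
      · exact iInf_le (fun D : c => OrderDual.ofDual D.1) ⟨D, hD⟩
      have : Nonempty c := ⟨⟨y, hy⟩⟩
      rw [OrderDual.ofDual_toDual, inf_iInf]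
      refine iInf_neBot_of_directed' (fun a b => ?_) fun D => hc D.2 x
      rcases hchain.total a.2 b.2 with hab | hab
      · exact ⟨b, inf_le_inf_left _ hab, le_rfl⟩
      · exact ⟨a, le_rfl, inf_le_inf_left _ hab⟩) (OrderDual.toDual D₁) h₁
  exact ⟨OrderDual.ofDual D, hD, hmax.1, fun D' hD' h =>
    le_antisymm hD' (hmax.2 (y := OrderDual.toDual D') h hD')⟩

theorem dense_decided_of_maximal {G : I → X} {D : Filter I}
    (hD : ∀ x, NeBot (comap G (𝓝 x) ⊓ D))
    (hmax : ∀ D' ≤ D, (∀ x, NeBot (comap G (𝓝 x) ⊓ D')) → D' = D) (A : Set I) :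
    Dense ({x | A ∈ comap G (𝓝 x) ⊓ D} ∪ {x | Aᶜ ∈ comap G (𝓝 x) ⊓ D}) := by
  rw [dense_iff_inter_open]
  intro N hN hne
  by_contra hcon
  have hcon : ∀ x ∈ N, A ∉ comap G (𝓝 x) ⊓ D ∧ Aᶜ ∉ comap G (𝓝 x) ⊓ D := fun x hx =>
    ⟨fun h => hcon ⟨x, hx, Or.inl h⟩, fun h => hcon ⟨x, hx, Or.inr h⟩⟩
  have hmem : (G ⁻¹' N)ᶜ ∪ A ∈ D := by
    have hD' := hmax (D ⊓ 𝓟 ((G ⁻¹' N)ᶜ ∪ A)) inf_le_left fun x => by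
      rw [← inf_assoc, ← frequently_mem_iff_neBot]
      intro hev
      have hev : G ⁻¹' N ∩ Aᶜ ∈ comap G (𝓝 x) ⊓ D := by
        filter_upwards [hev] with i hi
        simpa using hi
      have hM := isOpen_setOf_mem_comap_nhds_inf G D (G ⁻¹' N ∩ Aᶜ)
      obtain ⟨y, hyM, hy⟩ : ({y | G ⁻¹' N ∩ Aᶜ ∈ comap G (𝓝 y) ⊓ D} ∩ N).Nonempty := by
        by_contra hMN
        have := hD x
        obtain ⟨i, hi1, hi2, -⟩ := NeBot.nonempty_of_mem this (inter_mem
          (mem_inf_of_left (preimage_mem_comap (hM.mem_nhds hev))) hev)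
        exact hMN ⟨G i, hi1, hi2⟩
      exact (hcon y hy).2 (mem_of_superset hyM inter_subset_right)
    rw [← hD']
    exact mem_inf_of_right (mem_principal_self _)
  obtain ⟨x, hx⟩ := hne
  exact (hcon x hx).1 (mem_comap_nhds_inf_iff.2 ⟨N, hN, hx, hmem⟩)

end Trace

section Iteration

variable {A Λ : Type*} [LinearOrder Λ]

/-- Replace by `0` all coordinates in `Λ` above `β`. -/
def truncate (β : Λ) (x : A ⊕ Λ → ℕ) : A ⊕ Λ → ℕ :=
  Sum.elim (fun a => x (Sum.inl a)) fun γ => if γ ≤ β then x (Sum.inr γ) else 0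

theorem truncate_comp_truncate {β γ : Λ} (h : β ≤ γ) :
    truncate β ∘ truncate γ = truncate (A := A) β := by
  funext x k
  rcases k with a | δ
  · rfl
  · by_cases hδ : δ ≤ β
    · simp [truncate, hδ, hδ.trans h]
    · simp [truncate, hδ]

theorem truncate_update [DecidableEq A] {β α : Λ} (h : β < α) (x : A ⊕ Λ → ℕ) (n : ℕ) :
    truncate β (update x (Sum.inr α) n) = truncate β x := by
  funext k
  rcases k with a | δ
  · simp [truncate]
  · by_cases hδ : δ ≤ β
    · simp [truncate, hδ, (hδ.trans_lt h).ne]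
    · simp [truncate, hδ]

theorem mem_iff_of_map_truncate_eq {α : Λ} {W W' : Filter (A ⊕ Λ → ℕ)}
    (h : map (truncate α) W = map (truncate α) W') {S : Set (A ⊕ Λ → ℕ)}
    (hS : ∀ x, truncate α x ∈ S ↔ x ∈ S) : S ∈ W ↔ S ∈ W' := by
  have hpre : truncate α ⁻¹' S = S := Set.ext hS
  rw [← hpre, ← mem_map, ← mem_map, h]

theorem exists_ultrafilter_extending_coherent (F : Filter (A ⊕ Λ → ℕ)) [NeBot F] (s : Set Λ)
    (W : Λ → Ultrafilter (A ⊕ Λ → ℕ)) (hF : ∀ β ∈ s, (W β : Filter (A ⊕ Λ → ℕ)) ≤ F)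
    (hW : ∀ β ∈ s, ∀ γ ∈ s, β ≤ γ → map (truncate β) (W γ : Filter (A ⊕ Λ → ℕ)) =
      map (truncate β) (W β : Filter (A ⊕ Λ → ℕ))) :
    ∃ L : Ultrafilter (A ⊕ Λ → ℕ), (L : Filter (A ⊕ Λ → ℕ)) ≤ F ∧ ∀ β ∈ s,
      map (truncate β) (L : Filter (A ⊕ Λ → ℕ)) =
        map (truncate β) (W β : Filter (A ⊕ Λ → ℕ)) := by
  rcases s.eq_empty_or_nonempty with rfl | hs
  · exact ⟨Ultrafilter.of F, Ultrafilter.of_le F, by simp⟩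
  have : Nonempty s := hs.to_subtype
  let Φ : s → Filter (A ⊕ Λ → ℕ) := fun β => F ⊓ comap (truncate β.1) (map (truncate β.1) (W β))
  have hΦ : ∀ β γ : s, β.1 ≤ γ.1 → Φ γ ≤ Φ β := by
    intro β γ h
    refine inf_le_inf_left _ ?_
    rw [← truncate_comp_truncate h, ← comap_comap]
    refine comap_mono ?_
    rw [← map_le_iff_le_comap, map_map, truncate_comp_truncate h]
    exact (hW β β.2 γ γ.2 h).le
  have hne : NeBot (⨅ β, Φ β) := by
    refine iInf_neBot_of_directed' (fun β γ => ?_) fun β =>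
      (W β).neBot.mono (le_inf (hF β β.2) le_comap_map)
    rcases le_total β.1 γ.1 with h | h
    exacts [⟨γ, hΦ _ _ h, le_rfl⟩, ⟨β, le_rfl, hΦ _ _ h⟩]
  have hle : ∀ β, (Ultrafilter.of (⨅ β, Φ β) : Filter (A ⊕ Λ → ℕ)) ≤ Φ β := fun β =>
    (Ultrafilter.of_le _).trans (iInf_le _ β)
  refine ⟨Ultrafilter.of (⨅ β, Φ β), (hle (Classical.arbitrary s)).trans inf_le_left,
    fun β hβ => ?_⟩
  have h1 := map_le_iff_le_comap.2 ((hle ⟨β, hβ⟩).trans inf_le_right)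
  exact congrArg (fun u : Ultrafilter (A ⊕ Λ → ℕ) => (u : Filter (A ⊕ Λ → ℕ)))
    (Ultrafilter.eq_of_le (f := (Ultrafilter.of (⨅ β, Φ β)).map (truncate β))
    (g := (W β).map (truncate β)) h1)

variable [DecidableEq A]

/-- The iterate of an ultrafilter `L` along coordinate `α`: the new value of that coordinate is
chosen first, by a nonprincipal ultrafilter on `ℕ`. -/
noncomputable def prependCoord (α : Λ) (L : Ultrafilter (A ⊕ Λ → ℕ)) :
    Ultrafilter (A ⊕ Λ → ℕ) :=
  (hyperfilter ℕ).bind fun n => L.map fun x => update x (Sum.inr α) n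

theorem mem_prependCoord {α : Λ} {L : Ultrafilter (A ⊕ Λ → ℕ)} {S : Set (A ⊕ Λ → ℕ)} :
    S ∈ prependCoord α L ↔
      ∀ᶠ n in (hyperfilter ℕ : Filter ℕ), {x | update x (Sum.inr α) n ∈ S} ∈ L :=
  Iff.rfl

theorem exists_ultrafilter_coordinates_small [WellFoundedLT Λ] (F : Filter (A ⊕ Λ → ℕ)) [NeBot F]
    (hF : ∀ (α : Λ) (n : ℕ), Tendsto (fun x => update x (Sum.inr α) n) F F) :
    ∃ W : Ultrafilter (A ⊕ Λ → ℕ), (W : Filter (A ⊕ Λ → ℕ)) ≤ F ∧ ∀ α : Λ,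
      (∀ n, {x | n < x (Sum.inr α)} ∈ W) ∧
      ∀ S : ℕ → Set (A ⊕ Λ → ℕ), (∀ n, S n ∈ W) →
        (∀ n x y, (∀ k, (∀ β, k = Sum.inr β → β < α) → x k = y k) → (x ∈ S n ↔ y ∈ S n)) →
        {x | x ∈ S (x (Sum.inr α))} ∈ W := by
  classical
  let good : (α : Λ) → ((β : Λ) → β < α → Ultrafilter (A ⊕ Λ → ℕ)) →
      Ultrafilter (A ⊕ Λ → ℕ) → Prop := fun α fam L =>
    (L : Filter (A ⊕ Λ → ℕ)) ≤ F ∧ ∀ β (hβ : β < α),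
      map (truncate β) (L : Filter (A ⊕ Λ → ℕ)) =
        map (truncate β) (fam β hβ : Filter (A ⊕ Λ → ℕ))
  let pick : (α : Λ) → ((β : Λ) → β < α → Ultrafilter (A ⊕ Λ → ℕ)) →
      Ultrafilter (A ⊕ Λ → ℕ) := fun α fam => Classical.epsilon (good α fam)
  obtain ⟨W, hW⟩ : ∃ W : Λ → Ultrafilter (A ⊕ Λ → ℕ),
      ∀ α, W α = prependCoord α (pick α fun β _ => W β) :=
    ⟨(wellFounded_lt (α := Λ)).fix fun α fam => prependCoord α (pick α fam),
      fun α => WellFounded.fix_eq _ _ α⟩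
  have main : ∀ α, (W α : Filter (A ⊕ Λ → ℕ)) ≤ F ∧
      (∀ β ≤ α, map (truncate β) (W α : Filter (A ⊕ Λ → ℕ)) =
        map (truncate β) (W β : Filter (A ⊕ Λ → ℕ))) := by
    intro α
    induction α using WellFoundedLT.induction with
    | ind α ih =>
    obtain ⟨hL1, hL2⟩ : good α (fun β _ => W β) (pick α fun β _ => W β) :=
      Classical.epsilon_spec (exists_ultrafilter_extending_coherent F (Iio α) W
        (fun β hβ => (ih β hβ).1) fun β _ γ hγ h => (ih γ hγ).2 β h)
    constructor
    · intro S hS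
      rw [hW]
      exact mem_prependCoord.2 (Eventually.of_forall fun n => hL1 (hF α n hS))
    · intro β hβ
      rcases hβ.eq_or_lt with rfl | hβ
      · rfl
      rw [← hL2 β hβ]
      ext S
      rw [hW α, mem_map, mem_map]
      refine mem_prependCoord.trans ?_
      simp only [mem_preimage, truncate_update hβ]
      exact eventually_const
  obtain ⟨L, hLF, hL⟩ := exists_ultrafilter_extending_coherent F Set.univ W
    (fun β _ => (main β).1) fun β _ γ _ h => (main γ).2 β h
  refine ⟨L, hLF, fun α => ⟨fun n => ?_, fun S hS hdep => ?_⟩⟩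
  · refine (mem_iff_of_map_truncate_eq (hL α trivial) fun x => ?_).2 ?_
    · simp [truncate]
    · rw [hW]
      refine mem_prependCoord.2 ?_
      filter_upwards [(eventually_gt_atTop n).filter_mono Nat.hyperfilter_le_atTop] with m hm
      exact mem_of_superset univ_mem fun x _ => by simpa using hm
  · have htr : ∀ n x, truncate α x ∈ S n ↔ x ∈ S n := fun n x => hdep n _ _ fun k hk => by
      rcases k with a | β
      · rfl
      · simp [truncate, (hk β rfl).le]
    refine (mem_iff_of_map_truncate_eq (hL α trivial) fun x => ?_).2 ?_
    · change truncate α x ∈ S (truncate α x (Sum.inr α)) ↔ x ∈ S (x (Sum.inr α))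
      rw [htr, show truncate α x (Sum.inr α) = x (Sum.inr α) by simp [truncate]]
    · have hSW := fun n => (mem_iff_of_map_truncate_eq (hL α trivial) (htr n)).1 (hS n)
      rw [hW] at hSW ⊢
      have hup : ∀ n m x, update x (Sum.inr α) m ∈ S n ↔ x ∈ S n := fun n m x =>
        hdep n _ _ fun k hk => update_of_ne (fun h => (hk α h).false) _ _
      refine mem_prependCoord.2 (Eventually.of_forall fun n => ?_)
      have h1 := mem_prependCoord.1 (hSW n)
      simp only [hup] at h1
      simpa [hup] using h1

end Iteration

section PairedCoordinates

variable {Ω Λ : Type*} [LinearOrder Ω]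

/-- `H x` does not depend on the coordinates `(δ', b)` of `x` with `δ' ≥ δ`. -/
def DependsBelow (δ : Ω) (H : ((Ω × Bool) ⊕ Λ → ℕ) → Set ℕ) : Prop :=
  ∀ x y, (∀ k, (∀ δ' b, k = Sum.inl (δ', b) → δ' < δ) → x k = y k) → H x = H y

/-- The two values of `x` at `δ` are not separated by `H x`. -/
def Unseparated (δ : Ω) (H : ((Ω × Bool) ⊕ Λ → ℕ) → Set ℕ) (x : (Ω × Bool) ⊕ Λ → ℕ) : Prop :=
  x (Sum.inl (δ, false)) ∈ H x ↔ x (Sum.inl (δ, true)) ∈ H x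

theorem exists_unseparated_modification (T : Finset (Ω × (((Ω × Bool) ⊕ Λ → ℕ) → Set ℕ)))
    (hT : ∀ p ∈ T, DependsBelow p.1 p.2) (s : Finset Ω) :
    ∃ N : ℕ, ∀ x : (Ω × Bool) ⊕ Λ → ℕ, ∃ y : (Ω × Bool) ⊕ Λ → ℕ,
      (∀ k, (∀ δ ∈ s, ∀ b, k ≠ Sum.inl (δ, b)) → y k = x k) ∧
      (∀ δ ∈ s, ∀ b, y (Sum.inl (δ, b)) < N) ∧
      (∀ a a' : Ω × Bool, a.1 ∈ s → a'.1 ∈ s → y (Sum.inl a) = y (Sum.inl a') → a = a') ∧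
      ∀ p ∈ T, p.1 ∈ s → Unseparated p.1 p.2 y := by
  classical
  induction s using Finset.induction_on_max with
  | empty => exact ⟨0, fun x => ⟨x, by simp⟩⟩
  | insert δ s hδ ih =>
    obtain ⟨N, hN⟩ := ih
    refine ⟨N + 2 ^ T.card + 1, fun x => ?_⟩
    obtain ⟨y, hy1, hy2, hy3, hy4⟩ := hN x
    obtain ⟨u, hu, w, hw, huw, heq⟩ := Finset.exists_ne_map_eq_of_card_lt_of_maps_to
      (s := Finset.Ico N (N + 2 ^ T.card + 1)) (t := T.powerset)
      (f := fun n => T.filter fun p => n ∈ p.2 y) (by simp; omega)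
      (fun n _ => Finset.mem_coe.2 (Finset.mem_powerset.2 (Finset.filter_subset _ _)))
    rw [Finset.mem_Ico] at hu hw
    have huw' : ∀ p ∈ T, (u ∈ p.2 y ↔ w ∈ p.2 y) := fun p hp => by
      simpa [hp] using Finset.ext_iff.1 heq p
    let z : (Ω × Bool) ⊕ Λ → ℕ := fun k =>
      if k = Sum.inl (δ, false) then u else if k = Sum.inl (δ, true) then w else y k
    have hz0 : z (Sum.inl (δ, false)) = u := by simp [z]
    have hz1 : z (Sum.inl (δ, true)) = w := by simp [z]
    have hz : ∀ k, (∀ b, k ≠ Sum.inl (δ, b)) → z k = y k := fun k hk => by simp [z, hk]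
    have hzs : ∀ a : Ω × Bool, a.1 ∈ s → z (Sum.inl a) = y (Sum.inl a) := fun a ha =>
      hz _ fun b h => (hδ _ ha).ne (congrArg Prod.fst (Sum.inl_injective h))
    have hzδ : ∀ b, N ≤ z (Sum.inl (δ, b)) ∧ z (Sum.inl (δ, b)) < N + 2 ^ T.card + 1 := by
      rintro (_ | _)
      · rwa [hz0]
      · rwa [hz1]
    have hH : ∀ p ∈ T, p.1 ≤ δ → p.2 z = p.2 y := fun p hp hle =>
      hT p hp z y fun k hk => hz k fun b hb => (hk δ b hb).not_ge hle
    refine ⟨z, fun k hk => ?_, fun δ' hδ' b => ?_, ?_, fun p hp hps => ?_⟩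
    · rw [hz k (hk δ (Finset.mem_insert_self _ _))]
      exact hy1 k fun δ' hδ' => hk δ' (Finset.mem_insert_of_mem hδ')
    · rcases Finset.mem_insert.1 hδ' with rfl | hδ'
      · exact (hzδ b).2
      · rw [hzs (δ', b) hδ']
        have := hy2 δ' hδ' b
        omega
    · have hne : ∀ a : Ω × Bool, a.1 ∈ s → ∀ b, z (Sum.inl a) ≠ z (Sum.inl (δ, b)) :=
        fun a ha b => by
          have h1 := hzs a ha
          have h2 := hy2 a.1 ha a.2
          have h3 := (hzδ b).1
          simp only [Prod.mk.eta] at h2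
          omega
      rintro ⟨δ₁, b₁⟩ ⟨δ₂, b₂⟩ h₁ h₂ h
      rcases Finset.mem_insert.1 h₁ with h₁' | h₁' <;>
        rcases Finset.mem_insert.1 h₂ with h₂' | h₂'
      · change δ₁ = δ at h₁'
        change δ₂ = δ at h₂'
        subst h₁' h₂'
        cases b₁ <;> cases b₂
        · rfl
        · exact (huw (hz0.symm.trans (h.trans hz1))).elim
        · exact (huw (hz0.symm.trans (h.symm.trans hz1))).elim
        · rfl
      · change δ₁ = δ at h₁'
        subst h₁'
        exact (hne (δ₂, b₂) h₂' b₁ h.symm).elim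
      · change δ₂ = δ at h₂'
        subst h₂'
        exact (hne (δ₁, b₁) h₁' b₂ h).elim
      · rw [hzs _ h₁', hzs _ h₂'] at h
        exact hy3 _ _ h₁' h₂' h
    · rcases Finset.mem_insert.1 hps with hps | hps
      · rw [Unseparated, hH p hp hps.le, hps, hz0, hz1]
        exact huw' p hp
      · rw [Unseparated, hH p hp (hδ _ hps).le, hzs _ hps, hzs _ hps]
        exact hy4 p hp hps

/-- The filter generated by the dense open sets, the sets where two given coordinates in `Ω × Bool`
differ, and the sets of points unseparated at `δ` by `H`, where `H` depends only on the
coordinates below `δ`. -/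
def unseparatedFilter (Ω Λ : Type*) [LinearOrder Ω] : Filter ((Ω × Bool) ⊕ Λ → ℕ) where
  sets := {S | ∃ O : Set ((Ω × Bool) ⊕ Λ → ℕ), Dense (interior O) ∧
    ∃ T : Finset (Ω × (((Ω × Bool) ⊕ Λ → ℕ) → Set ℕ)), (∀ p ∈ T, DependsBelow p.1 p.2) ∧
    ∃ s : Finset (Ω × Bool), ∀ x ∈ O,
      (∀ a ∈ s, ∀ a' ∈ s, x (Sum.inl a) = x (Sum.inl a') → a = a') →
      (∀ p ∈ T, Unseparated p.1 p.2 x) → x ∈ S}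
  univ_sets := ⟨Set.univ, by simp, ∅, by simp, ∅, by simp⟩
  sets_of_superset := by
    rintro S S' ⟨O, hO, T, hT, s, h⟩ hS
    exact ⟨O, hO, T, hT, s, fun x hx h1 h2 => hS (h x hx h1 h2)⟩
  inter_sets := by
    classical
    rintro S S' ⟨O, hO, T, hT, s, h⟩ ⟨O', hO', T', hT', s', h'⟩
    refine ⟨O ∩ O', dense_interior_inter hO hO', T ∪ T', fun p hp => ?_, s ∪ s',
      fun x hx h1 h2 => ⟨h x hx.1 (fun a ha a' ha' => ?_) fun p hp => ?_,
        h' x hx.2 (fun a ha a' ha' => ?_) fun p hp => ?_⟩⟩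
    · exact (Finset.mem_union.1 hp).elim (hT p) (hT' p)
    · exact h1 a (Finset.mem_union_left _ ha) a' (Finset.mem_union_left _ ha')
    · exact h2 p (Finset.mem_union_left _ hp)
    · exact h1 a (Finset.mem_union_right _ ha) a' (Finset.mem_union_right _ ha')
    · exact h2 p (Finset.mem_union_right _ hp)

theorem mem_unseparatedFilter_of_dense {O : Set ((Ω × Bool) ⊕ Λ → ℕ)} (hO : Dense (interior O)) :
    O ∈ unseparatedFilter Ω Λ :=
  ⟨O, hO, ∅, by simp, ∅, fun _ hx _ _ => hx⟩

theorem ne_mem_unseparatedFilter {a a' : Ω × Bool} (h : a ≠ a') :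
    {x | x (Sum.inl a) ≠ x (Sum.inl a')} ∈ unseparatedFilter Ω Λ := by
  classical
  exact ⟨Set.univ, by simp, ∅, by simp, {a, a'}, fun x _ h1 _ h2 =>
    h (h1 a (by simp) a' (by simp) h2)⟩

theorem unseparated_mem_unseparatedFilter {δ : Ω} {H : ((Ω × Bool) ⊕ Λ → ℕ) → Set ℕ}
    (h : DependsBelow δ H) : {x | Unseparated δ H x} ∈ unseparatedFilter Ω Λ :=
  ⟨Set.univ, by simp, {(δ, H)}, by simpa using h, ∅, fun x _ _ h2 => h2 (δ, H) (by simp)⟩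

instance unseparatedFilter_neBot : NeBot (unseparatedFilter Ω Λ) := by
  classical
  refine neBot_iff.2 fun hbot => ?_
  obtain ⟨O, hO, T, hT, s, h⟩ : ∅ ∈ unseparatedFilter Ω Λ := hbot ▸ mem_bot
  let s' : Finset Ω := s.image Prod.fst ∪ T.image Prod.fst
  obtain ⟨N, hN⟩ := exists_unseparated_modification T hT s'
  obtain ⟨O', hO', hmod⟩ := exists_dense_open_forall_modification
    ((s' ×ˢ (Finset.univ : Finset Bool)).map (Embedding.inl (β := Λ))) N hO
  obtain ⟨x, hx⟩ := hO'.nonempty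
  obtain ⟨y, hy1, hy2, hy3, hy4⟩ := hN x
  refine h y (hmod x (interior_subset hx) y (fun k hk => hy1 k ?_) ?_) ?_ ?_
  · rintro δ hδ b rfl
    exact hk (Finset.mem_map.2 ⟨(δ, b), by simpa using hδ, rfl⟩)
  · intro k hk
    obtain ⟨⟨δ, b⟩, hδ, rfl⟩ := Finset.mem_map.1 hk
    exact hy2 δ (by simpa using hδ) b
  · exact fun a ha a' ha' => hy3 a a' (Finset.mem_union_left _ (Finset.mem_image_of_mem _ ha))
      (Finset.mem_union_left _ (Finset.mem_image_of_mem _ ha'))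
  · exact fun p hp => hy4 p hp (Finset.mem_union_right _ (Finset.mem_image_of_mem _ hp))

theorem tendsto_update_unseparatedFilter [DecidableEq ((Ω × Bool) ⊕ Λ)] (α : Λ) (n : ℕ) :
    Tendsto (fun x => update x (Sum.inr α) n) (unseparatedFilter Ω Λ) (unseparatedFilter Ω Λ) := by
  classical
  rintro S ⟨O, hO, T, hT, s, h⟩
  refine ⟨_, dense_interior_preimage_update hO (Sum.inr α) n,
    T.image fun p => (p.1, fun x => p.2 (update x (Sum.inr α) n)), ?_, s,
    fun x hx h1 h2 => h _ hx (fun a ha a' ha' => ?_) fun p hp => ?_⟩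
  · intro p hp
    obtain ⟨q, hq, rfl⟩ := Finset.mem_image.1 hp
    refine fun x y hxy => hT q hq _ _ fun k hk => ?_
    by_cases hkα : k = Sum.inr α
    · simp [hkα]
    · simpa [hkα] using hxy k hk
  · simpa using h1 a ha a' ha'
  · simpa [Unseparated] using h2 _ (Finset.mem_image_of_mem _ hp)

end PairedCoordinates

section IndependentFamily

variable {I K : Type u}

theorem exists_finset_filter_injOn [DecidableEq I] {A : K → Set I} (hA : Injective A)
    [∀ k i, Decidable (i ∈ A k)] (t : Finset K) :
    ∃ F : Finset I, Set.InjOn (fun k => F.filter (· ∈ A k)) t := by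
  have hsep : ∀ p : K × K, ∃ s : Finset I, p.1 ≠ p.2 → ∃ i ∈ s, ¬(i ∈ A p.1 ↔ i ∈ A p.2) := by
    intro p
    by_cases h : p.1 = p.2
    · exact ⟨∅, fun h' => (h' h).elim⟩
    · obtain ⟨i, hi⟩ := not_forall.1 (mt Set.ext (hA.ne h))
      exact ⟨{i}, fun _ => ⟨i, by simp, hi⟩⟩
  choose s hs using hsep
  refine ⟨(t ×ˢ t).biUnion s, fun k hk k' hk' h => ?_⟩
  by_contra hne
  obtain ⟨i, hi, hik⟩ := hs (k, k') hne
  have hF : i ∈ (t ×ˢ t).biUnion s :=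
    Finset.mem_biUnion.2 ⟨(k, k'), Finset.mem_product.2 ⟨hk, hk'⟩, hi⟩
  exact hik (by simpa only [Finset.mem_filter, hF, true_and] using Finset.ext_iff.1 h i)

/-- An independent family of `2 ^ #I` functions `I → ℕ`, together with a regularizing family which
is independent from it. -/
theorem exists_independent_family [Infinite I] (hK : #K ≤ 2 ^ #I) :
    ∃ (G : I → K → ℕ) (F : I → Finset I), ∀ (x : K → ℕ) (t : Finset K) (s : Finset I),
      ∃ i, (∀ k ∈ t, G i k = x k) ∧ s ⊆ F i := by
  classical
  obtain ⟨e⟩ : Nonempty (I ≃ Finset I × Finset I × (Finset I →₀ ℕ)) := by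
    refine Cardinal.eq.1 ?_
    have h := aleph0_le_mk I
    simp [mk_finset_of_infinite, mul_eq_self h, h]
  obtain ⟨A⟩ : Nonempty (K ↪ Set I) := by
    rwa [← mk_set, Cardinal.le_def] at hK
  refine ⟨fun i k => (e i).2.2 ((e i).2.1.filter (· ∈ A k)), fun i => (e i).1, fun x t s => ?_⟩
  obtain ⟨F, hF⟩ := exists_finset_filter_injOn A.injective t
  let φ : Finset I →₀ ℕ := ∑ k ∈ t, Finsupp.single (F.filter (· ∈ A k)) (x k)
  refine ⟨e.symm (s, F, φ), fun k hk => ?_, by simp⟩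
  simp only [Equiv.apply_symm_apply, φ, Finsupp.finsetSum_apply]
  rw [Finset.sum_eq_single k]
  · simp
  · exact fun k' hk' hne => Finsupp.single_eq_of_ne fun h => hne (hF hk' hk h.symm)
  · exact fun h => (h hk).elim

theorem exists_regular_filter_comap_nhds_inf_neBot [Infinite I] (hK : #K ≤ 2 ^ #I) :
    ∃ (G : I → K → ℕ) (F : I → Finset I) (D : Filter I), (∀ i, {t | i ∈ F t} ∈ D) ∧
      ∀ x, NeBot (comap G (𝓝 x) ⊓ D) := by
  classical
  obtain ⟨G, F, h⟩ := exists_independent_family hK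
  refine ⟨G, F, comap F atTop, fun i => ⟨{s | {i} ≤ s}, mem_atTop _, fun t ht => ?_⟩, fun x => ?_⟩
  · simpa using ht
  · rw [inf_neBot_iff]
    rintro S ⟨N, hN, hNS⟩ T ⟨B, hB, hBT⟩
    obtain ⟨s, hs⟩ := mem_atTop_sets.1 hB
    obtain ⟨N', hN', ho, hx⟩ := mem_nhds_iff.1 hN
    obtain ⟨t, ht⟩ := exists_cyl_subset ho hx
    obtain ⟨i, hi1, hi2⟩ := h x t s
    refine ⟨i, hNS (hN' (ht ?_)), hBT (hs _ hi2)⟩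
    intro p hp
    obtain ⟨k, hk, rfl⟩ := Finset.mem_map.1 hp
    exact hi1 k hk

end IndependentFamily

section DecidedUltrafilter

variable {I K : Type u} {G : I → K → ℕ} {D : Filter I} {W : Ultrafilter (K → ℕ)} {U : Ultrafilter I}

theorem exists_ultrafilter_mem_iff (hne : ∀ x, NeBot (comap G (𝓝 x) ⊓ D))
    (hdec : ∀ A : Set I,
      Dense ({x | A ∈ comap G (𝓝 x) ⊓ D} ∪ {x | Aᶜ ∈ comap G (𝓝 x) ⊓ D}))
    (hW : ∀ O : Set (K → ℕ), Dense (interior O) → O ∈ W) :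
    ∃ U : Ultrafilter I, ∀ A, A ∈ U ↔ {x | A ∈ comap G (𝓝 x) ⊓ D} ∈ W := by
  refine ⟨Ultrafilter.ofComplNotMemIff ((W : Filter (K → ℕ)).bind fun x => comap G (𝓝 x) ⊓ D)
    fun A => ⟨fun h => ?_, fun h h' => ?_⟩, fun A => Iff.rfl⟩
  · have hopen : IsOpen ({x | A ∈ comap G (𝓝 x) ⊓ D} ∪ {x | Aᶜ ∈ comap G (𝓝 x) ⊓ D}) :=
      (isOpen_setOf_mem_comap_nhds_inf G D A).union (isOpen_setOf_mem_comap_nhds_inf G D Aᶜ)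
    have h2 := hW _ (hopen.interior_eq.symm ▸ hdec A)
    exact (Ultrafilter.union_mem_iff.1 h2).resolve_right h
  · obtain ⟨x, hx, hx'⟩ := W.neBot.nonempty_of_mem (inter_mem (Filter.mem_bind'.1 h)
      (Filter.mem_bind'.1 h'))
    have := hne x
    exact not_mem_comap_nhds_inf_compl hx hx'

theorem mem_ultrafilter_of_coordinate (hU : ∀ A, A ∈ U ↔ {x | A ∈ comap G (𝓝 x) ⊓ D} ∈ W)
    {N : Set (K → ℕ)} (hN : IsOpen N) (h : N ∈ W) : G ⁻¹' N ∈ U :=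
  (hU _).2 (mem_of_superset h fun _ hx => mem_inf_of_left (preimage_mem_comap (hN.mem_nhds hx)))

theorem coordinate_eq_mem_comap_nhds_inf (G : I → K → ℕ) (D : Filter I) (x : K → ℕ) (k : K) :
    {t | G t k = x k} ∈ comap G (𝓝 x) ⊓ D := by
  have h : IsOpen ((fun y : K → ℕ => y k) ⁻¹' {x k}) :=
    (isOpen_discrete _).preimage (continuous_apply k)
  exact mem_inf_of_left (preimage_mem_comap (h.mem_nhds rfl))

theorem exists_countable_coordCore_mem [DecidableEq K] (hne : ∀ x, NeBot (comap G (𝓝 x) ⊓ D))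
    (hdec : ∀ A : Set I,
      Dense ({x | A ∈ comap G (𝓝 x) ⊓ D} ∪ {x | Aᶜ ∈ comap G (𝓝 x) ⊓ D}))
    (hW : ∀ O : Set (K → ℕ), Dense (interior O) → O ∈ W)
    (hU : ∀ A, A ∈ U ↔ {x | A ∈ comap G (𝓝 x) ⊓ D} ∈ W) {A : Set I} (hA : A ∈ U) :
    ∃ C : Set K, C.Countable ∧ coordCore C {x | A ∈ comap G (𝓝 x) ⊓ D} ∈ W := by
  obtain ⟨C, hC, hd⟩ := exists_countable_coordCore (isOpen_setOf_mem_comap_nhds_inf G D A)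
    (isOpen_setOf_mem_comap_nhds_inf G D Aᶜ) (hdec A)
  refine ⟨C, hC, (Ultrafilter.union_mem_iff.1 (hW _ hd)).resolve_right fun h => ?_⟩
  obtain ⟨x, hx, hx'⟩ := W.neBot.nonempty_of_mem (inter_mem ((hU A).1 hA) h)
  have := hne x
  exact not_mem_comap_nhds_inf_compl hx (coordCore_subset _ _ hx')

end DecidedUltrafilter

section PairedUltrafilter

variable {I Ω Λ : Type u} [LinearOrder Ω] {G : I → (Ω × Bool) ⊕ Λ → ℕ}
  {D : Filter I} {W : Ultrafilter ((Ω × Bool) ⊕ Λ → ℕ)} {U : Ultrafilter I}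

theorem coordinate_ne_mem (hW : (W : Filter ((Ω × Bool) ⊕ Λ → ℕ)) ≤ unseparatedFilter Ω Λ)
    (hU : ∀ A, A ∈ U ↔ {x | A ∈ comap G (𝓝 x) ⊓ D} ∈ W) {a a' : Ω × Bool} (h : a ≠ a') :
    {t | G t (Sum.inl a) ≠ G t (Sum.inl a')} ∈ U :=
  mem_ultrafilter_of_coordinate (N := {x | x (Sum.inl a) ≠ x (Sum.inl a')}) hU
    (isOpen_ne_fun (continuous_apply (Sum.inl a)) (continuous_apply (Sum.inl a')))
    (hW (ne_mem_unseparatedFilter h))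

theorem exists_not_separated (hΩ : ∀ B : Set Ω, B.Countable → ∃ δ, ∀ δ' ∈ B, δ' < δ)
    (hne : ∀ x, NeBot (comap G (𝓝 x) ⊓ D))
    (hdec : ∀ A : Set I,
      Dense ({x | A ∈ comap G (𝓝 x) ⊓ D} ∪ {x | Aᶜ ∈ comap G (𝓝 x) ⊓ D}))
    (hW : (W : Filter ((Ω × Bool) ⊕ Λ → ℕ)) ≤ unseparatedFilter Ω Λ)
    (hU : ∀ A, A ∈ U ↔ {x | A ∈ comap G (𝓝 x) ⊓ D} ∈ W) (P : I → ℕ → Prop) :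
    ∃ δ : Ω, {t | P t (G t (Sum.inl (δ, false)))} ∈ U →
      {t | P t (G t (Sum.inl (δ, true)))} ∈ U := by
  classical
  have key := fun u : ℕ => exists_countable_coordCore
    (isOpen_setOf_mem_comap_nhds_inf G D {t | P t u})
    (isOpen_setOf_mem_comap_nhds_inf G D {t | P t u}ᶜ) (hdec _)
  choose C hC hCd using key
  obtain ⟨δ, hδ⟩ := hΩ {δ | ∃ u b, Sum.inl (δ, b) ∈ C u} <| by
    refine (countable_iUnion fun u => ((hC u).preimage Sum.inl_injective).image Prod.fst).mono ?_
    rintro δ ⟨u, b, h⟩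
    exact mem_iUnion.2 ⟨u, (δ, b), h, rfl⟩
  refine ⟨δ, fun h0 => ?_⟩
  by_contra h1
  rw [← Ultrafilter.compl_mem_iff_notMem] at h1
  let H : ((Ω × Bool) ⊕ Λ → ℕ) → Set ℕ := fun x =>
    {u | x ∈ coordCore (C u) {x | {t | P t u} ∈ comap G (𝓝 x) ⊓ D}}
  have hH : DependsBelow δ H := fun x y hxy => Set.ext fun u => by
    refine mem_coordCore_congr fun k hk => hxy k ?_
    rintro δ' b rfl
    exact hδ δ' ⟨u, b, hk⟩
  have hdiag := mem_unseparatedFilter_of_dense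
    (dense_interior_diagonal hCd (Sum.inl (δ, false)))
  obtain ⟨x, ⟨⟨hx0, hx1⟩, hxu⟩, hxd⟩ := W.neBot.nonempty_of_mem (inter_mem (inter_mem (inter_mem
    ((hU _).1 h0) ((hU _).1 h1)) (hW (unseparated_mem_unseparatedFilter hH))) (hW hdiag))
  have := hne x
  have hval : ∀ b, {t | G t (Sum.inl (δ, b)) = x (Sum.inl (δ, b))} ∈ comap G (𝓝 x) ⊓ D :=
    fun b => coordinate_eq_mem_comap_nhds_inf G D x _
  have hmem : x (Sum.inl (δ, false)) ∈ H x := by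
    refine hxd.resolve_right fun h => ?_
    have h2 : {t | P t (x (Sum.inl (δ, false)))}ᶜ ∈ comap G (𝓝 x) ⊓ D := coordCore_subset _ _ h
    obtain ⟨t, ⟨ht1, ht2⟩, ht3⟩ := Filter.nonempty_of_mem (inter_mem (inter_mem h2 (hval false)) hx0)
    exact ht1 (ht2 ▸ ht3)
  have h2 : {t | P t (x (Sum.inl (δ, true)))} ∈ comap G (𝓝 x) ⊓ D :=
    coordCore_subset _ _ (hxu.1 hmem)
  obtain ⟨t, ⟨ht1, ht2⟩, ht3⟩ := Filter.nonempty_of_mem (inter_mem (inter_mem h2 (hval true)) hx1)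
  exact ht3 (show P t (G t (Sum.inl (δ, true))) from ht2.symm ▸ ht1)

theorem exists_nonstandard_below [LinearOrder Λ] {lam : Cardinal.{u}} (hlam : ℵ₀ ≤ lam)
    (hΛ : ∀ B : Set Λ, #B ≤ lam → ∃ α, ∀ β ∈ B, β < α)
    (hne : ∀ x, NeBot (comap G (𝓝 x) ⊓ D))
    (hdec : ∀ A : Set I,
      Dense ({x | A ∈ comap G (𝓝 x) ⊓ D} ∪ {x | Aᶜ ∈ comap G (𝓝 x) ⊓ D}))
    (hW : ∀ O : Set ((Ω × Bool) ⊕ Λ → ℕ), Dense (interior O) → O ∈ W)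
    (hU : ∀ A, A ∈ U ↔ {x | A ∈ comap G (𝓝 x) ⊓ D} ∈ W)
    (hsmall : ∀ α : Λ, (∀ n, {x | n < x (Sum.inr α)} ∈ W) ∧
      ∀ S : ℕ → Set ((Ω × Bool) ⊕ Λ → ℕ), (∀ n, S n ∈ W) →
        (∀ n x y, (∀ k, (∀ β, k = Sum.inr β → β < α) → x k = y k) → (x ∈ S n ↔ y ∈ S n)) →
        {x | x ∈ S (x (Sum.inr α))} ∈ W)
    (S : Set (I → ℕ)) (hS : ∀ f ∈ S, IsNonstandard (U : Filter I) f) (hcard : #S ≤ lam) :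
    ∃ g : I → ℕ, IsNonstandard (U : Filter I) g ∧ ∀ f ∈ S, ltD (U : Filter I) g f := by
  classical
  have key : ∀ p : S × ℕ, ∃ C : Set ((Ω × Bool) ⊕ Λ), C.Countable ∧
      coordCore C {x | {t | p.2 < p.1.1 t} ∈ comap G (𝓝 x) ⊓ D} ∈ W := fun p =>
    exists_countable_coordCore_mem hne hdec hW hU (hS p.1.1 p.1.2 p.2)
  choose C hC hCW using key
  obtain ⟨α, hα⟩ := hΛ (⋃ p, Sum.inr ⁻¹' C p) <| by
    refine (mk_iUnion_le _).trans ((mul_le_mul' ?_ (ciSup_le' fun p =>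
      ((hC p).preimage Sum.inr_injective).le_aleph0)).trans (mul_eq_left hlam hlam
        aleph0_ne_zero).le)
    simpa using (mul_le_mul' hcard le_rfl).trans (mul_eq_left hlam hlam aleph0_ne_zero).le
  refine ⟨fun t => G t (Sum.inr α), fun n => ?_, fun f hf => ?_⟩
  · exact mem_ultrafilter_of_coordinate hU
      ((isOpen_discrete (Set.Ioi n)).preimage (continuous_apply (Sum.inr α))) ((hsmall α).1 n)
  · refine (hU _).2 (mem_of_superset ((hsmall α).2
      (fun n => coordCore (C (⟨f, hf⟩, n)) {x | {t | n < f t} ∈ comap G (𝓝 x) ⊓ D})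
      (fun n => hCW (⟨f, hf⟩, n)) fun n x y hxy => ?_) fun x hx => ?_)
    · refine mem_coordCore_congr fun k hk => hxy k ?_
      rintro β rfl
      exact hα β (mem_iUnion.2 ⟨_, hk⟩)
    · have h1 : {t | x (Sum.inr α) < f t} ∈ comap G (𝓝 x) ⊓ D := coordCore_subset _ _ hx
      filter_upwards [h1, coordinate_eq_mem_comap_nhds_inf G D x (Sum.inr α)] with t ht ht'
      exact lt_of_eq_of_lt ht' ht

end PairedUltrafilter

section EvenOrdinal

variable (β γ : Ordinal.{u})

theorem evenOrdinal_two_mul : EvenOrdinal (2 * β) := ⟨β, rfl⟩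

theorem ordinal_div_two_le : γ / 2 ≤ γ :=
  Ordinal.div_le_of_le_mul (Ordinal.le_mul_right γ two_pos)

theorem two_mul_add_one_div_two : (2 * β + 1) / 2 = β := by
  rw [Ordinal.mul_add_div _ two_ne_zero, Ordinal.div_eq_zero_of_lt one_lt_two, add_zero]

theorem not_evenOrdinal_two_mul_add_one_s8 : ¬EvenOrdinal (2 * β + 1) := by
  rintro ⟨δ, h⟩
  have h' := congrArg (· % 2) h
  simp [Ordinal.mul_add_mod_self, Ordinal.mod_eq_of_lt one_lt_two] at h'

theorem eq_two_mul_or_eq_two_mul_add_one : γ = 2 * (γ / 2) ∨ γ = 2 * (γ / 2) + 1 := by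
  have h : γ % 2 = 0 ∨ γ % 2 = 1 := by
    have : γ % 2 < 2 := Ordinal.mod_lt γ two_ne_zero
    rwa [← one_add_one_eq_two (R := Ordinal.{u}), Order.lt_add_one_iff, Order.le_one_iff,
      one_add_one_eq_two] at this
  have h' := Ordinal.div_add_mod γ 2
  rcases h with h | h <;> rw [h] at h'
  exacts [Or.inl (by simpa using h'.symm), Or.inr h'.symm]

variable {β γ}

theorem eq_of_div_two_eq (h : β / 2 = γ / 2) (h' : EvenOrdinal β ↔ EvenOrdinal γ) : β = γ := by
  rcases eq_two_mul_or_eq_two_mul_add_one β with hβ | hβ <;>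
    rcases eq_two_mul_or_eq_two_mul_add_one γ with hγ | hγ
  · rw [hβ, hγ, h]
  · rw [hβ, hγ] at h'
    exact (not_evenOrdinal_two_mul_add_one_s8 _ (h'.1 (evenOrdinal_two_mul _))).elim
  · rw [hβ, hγ] at h'
    exact (not_evenOrdinal_two_mul_add_one_s8 _ (h'.2 (evenOrdinal_two_mul _))).elim
  · rw [hβ, hγ, h]

theorem two_mul_add_one_lt_ord {c : Cardinal.{u}} (hc : ℵ₀ ≤ c) (h : β < c.ord) :
    2 * β + 1 < c.ord := by
  rw [lt_ord] at h ⊢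
  have h2 : (2 : Cardinal.{u}) < c := (natCast_lt_aleph0 (n := 2)).trans_le hc
  have h1 : (1 : Cardinal.{u}) < c := one_lt_aleph0.trans_le hc
  simpa using add_lt_of_lt hc (mul_lt_of_lt hc h2 h) h1

/-- Index the ordinals below `c` by pairs, so that `2 * β` and `2 * β + 1` are indexed by
`(β, false)` and `(β, true)`. -/
theorem exists_paired_index {c : Cardinal.{u}} (hc : ℵ₀ ≤ c) :
    ∃ idx : Ordinal.{u} → c.ord.ToType × Bool, Set.InjOn idx (Iio c.ord) ∧
      ∀ δ, ∃ β, 2 * β + 1 < c.ord ∧ idx (2 * β) = (δ, false) ∧ idx (2 * β + 1) = (δ, true) := by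
  classical
  let v : c.ord.ToType → Ordinal.{u} := fun δ => Ordinal.ToType.mk.symm δ
  have hv : Injective v := Subtype.val_injective.comp Ordinal.ToType.mk.symm.injective
  have hsurj : ∀ γ < c.ord, ∃ δ, v δ = γ := fun γ hγ => ⟨Ordinal.ToType.mk ⟨γ, hγ⟩, by simp [v]⟩
  have : Nonempty c.ord.ToType :=
    mk_ne_zero_iff.1 (by simpa using (aleph0_pos.trans_le hc).ne')
  have hleft := leftInverse_invFun hv
  refine ⟨fun γ => (invFun v (γ / 2), decide ¬EvenOrdinal γ), fun β hβ γ hγ h => ?_, fun δ =>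
    ⟨v δ, two_mul_add_one_lt_ord hc (Ordinal.ToType.mk.symm δ).2, ?_, ?_⟩⟩
  · obtain ⟨h1, h2⟩ := Prod.ext_iff.1 h
    refine eq_of_div_two_eq ?_ (not_iff_not.1 (decide_eq_decide.1 h2))
    rw [← invFun_eq (hsurj _ ((ordinal_div_two_le β).trans_lt hβ)),
      ← invFun_eq (hsurj _ ((ordinal_div_two_le γ).trans_lt hγ))]
    exact congrArg v h1
  · simp [evenOrdinal_two_mul, hleft δ]
  · simp [two_mul_add_one_div_two, not_evenOrdinal_two_mul_add_one_s8, hleft δ]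

end EvenOrdinal

theorem exists_forall_lt_of_mk_lt {c : Cardinal.{u}} (hc : c.IsRegular) {B : Set c.ord.ToType}
    (hB : #B < c) : ∃ δ, ∀ δ' ∈ B, δ' < δ := by
  rw [← not_isCofinal_iff]
  intro h
  have := Order.cof_le h
  rw [Ordinal.cof_toType, hc.cof_ord] at this
  exact this.not_gt hB

theorem mk_paired_sum_le_two_power {lam : Cardinal.{u}} (hlam : aleph 2 ≤ lam) :
    #((aleph.{u} 1).ord.ToType × Bool ⊕ (Order.succ lam).ord.ToType) ≤ 2 ^ lam := by
  have hω : ℵ₀ ≤ (2 : Cardinal.{u}) ^ lam :=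
    ((aleph0_le_aleph 2).trans hlam).trans (cantor lam).le
  have h1 : aleph 1 ≤ (2 : Cardinal.{u}) ^ lam :=
    ((aleph_le_aleph.2 one_le_two).trans hlam).trans (cantor lam).le
  simp only [mk_sum, mk_prod, mk_ord_toType, lift_uzero, lift_id, mk_bool, lift_ofNat]
  exact add_le_of_le hω (mul_le_of_le hω h1 ((natCast_lt_aleph0 (n := 2)).le.trans hω))
    (Order.succ_le_of_lt (cantor lam))

theorem isRegularFilter_of_mem {I : Type u} {lam : Cardinal.{u}} (hI : #I = lam) {D : Filter I}
    (F : I → Finset I) (hF : ∀ i, {t | i ∈ F t} ∈ D) : IsRegularFilter lam D := by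
  classical
  obtain ⟨e⟩ : Nonempty (lam.ord.ToType ≃ I) := Cardinal.eq.1 (by simp [hI])
  refine ⟨fun i => {t | ∀ h : i < lam.ord, e (Ordinal.ToType.mk ⟨i, h⟩) ∈ F t},
    fun i hi => mem_of_superset (hF (e (Ordinal.ToType.mk ⟨i, hi⟩))) fun t ht _ => ht, fun t => ?_⟩
  refine ((F t).finite_toSet.image fun j => (Ordinal.ToType.mk.symm (e.symm j)).1).subset ?_
  rintro i ⟨hi, hit⟩
  exact ⟨_, hit hi, by simp⟩

theorem infinite_of_extension {V : Type*} {R : V → V → Prop} (hirr : ∀ x, ¬R x x)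
    (hrg : ∀ U W : Finset V, Disjoint U W → ∃ x : V, (∀ a ∈ U, R x a) ∧ ∀ b ∈ W, ¬ R x b) :
    Infinite V := by
  by_contra h
  have := not_infinite_iff_finite.1 h
  cases nonempty_fintype V
  obtain ⟨x, hx, -⟩ := hrg Finset.univ ∅ (Finset.disjoint_empty_right _)
  exact hirr x (hx x (Finset.mem_univ x))

theorem exists_realization_of_finset {I V ι : Type*} {R : V → V → Prop} {U : Ultrafilter I}
    (hrg : ∀ U W : Finset V, Disjoint U W → ∃ x : V, (∀ a ∈ U, R x a) ∧ ∀ b ∈ W, ¬ R x b)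
    (f : ι → I → V) (s : Finset ι) (hf : ∀ i ∈ s, ∀ j ∈ s, i ≠ j → {t | f i t ≠ f j t} ∈ U)
    (p : ι → Prop) : ∃ h : I → V, ∀ i ∈ s, ({t | R (h t) (f i t)} ∈ U ↔ p i) := by
  classical
  have key : ∀ t, ∃ x, (∀ i ∈ s, ∀ j ∈ s, i ≠ j → f i t ≠ f j t) →
      ∀ i ∈ s, (R x (f i t) ↔ p i) := by
    intro t
    by_cases ht : ∀ i ∈ s, ∀ j ∈ s, i ≠ j → f i t ≠ f j t
    · obtain ⟨x, hx1, hx2⟩ := hrg ((s.filter p).image (f · t)) ((s.filter (¬p ·)).image (f · t)) <| by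
        rw [Finset.disjoint_left]
        intro v hv hv'
        obtain ⟨i, hi, rfl⟩ := Finset.mem_image.1 hv
        obtain ⟨j, hj, hij⟩ := Finset.mem_image.1 hv'
        rw [Finset.mem_filter] at hi hj
        exact ht i hi.1 j hj.1 (fun h => hj.2 (h ▸ hi.2)) hij.symm
      refine ⟨x, fun _ i hi => ?_⟩
      by_cases hpi : p i
      · simpa [hpi] using hx1 _ (Finset.mem_image_of_mem (f · t) (Finset.mem_filter.2 ⟨hi, hpi⟩))
      · simpa [hpi] using hx2 _ (Finset.mem_image_of_mem (f · t) (Finset.mem_filter.2 ⟨hi, hpi⟩))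
    · exact ⟨(hrg ∅ ∅ (Finset.disjoint_empty_right _)).choose, fun h => (ht h).elim⟩
  choose h hh using key
  have hmem : ∀ᶠ t in (U : Filter I), ∀ i ∈ s, ∀ j ∈ s, i ≠ j → f i t ≠ f j t := by
    rw [Filter.eventually_all_finset]
    intro i hi
    rw [Filter.eventually_all_finset]
    intro j hj
    exact eventually_imp_distrib_left.2 (hf i hi j hj)
  refine ⟨h, fun i hi => ?_⟩
  change (∀ᶠ t in (U : Filter I), R (h t) (f i t)) ↔ p i
  rw [eventually_congr (hmem.mono fun t ht => hh t ht i hi)]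
  exact eventually_const

/-- for `lam ≥ ℵ₂` there is (in ZFC) a `lam`-regular ultrafilter on a set of
cardinality `lam` with `lcf(ℵ₀) ≥ lam⁺` which does not saturate the countable random graph:
an `ℵ₁`-sequence of pairwise-distinct elements over which the corresponding random-graph type
is finitely satisfiable but omitted. -/
theorem large_lcf_without_saturating_random_graph {I : Type u} (lam : Cardinal.{u})
    (hlam : Cardinal.aleph 2 ≤ lam) (hI : #I = lam)
    (V : Type u) [Countable V] (R : V → V → Prop)
    (hsymm : Symmetric R) (hirr : Irreflexive R)
    (hrg : ∀ U W : Finset V, Disjoint U W →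
      ∃ x : V, (∀ a ∈ U, R x a) ∧ ∀ b ∈ W, ¬ R x b) :
    ∃ Dstar : Ultrafilter I, IsRegularFilter lam (Dstar : Filter I) ∧
      (∀ S : Set (I → ℕ), (∀ f ∈ S, IsNonstandard (Dstar : Filter I) f) → #S ≤ lam →
        ∃ g : I → ℕ, IsNonstandard (Dstar : Filter I) g ∧
          ∀ f ∈ S, ltD (Dstar : Filter I) g f) ∧
      ∃ f : Ordinal.{u} → I → V,
        (∀ γ δ : Ordinal.{u}, γ < δ → δ < (Cardinal.aleph 1).ord →
          {t : I | f γ t = f δ t} ∉ Dstar) ∧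
        (∀ uu : Finset Ordinal.{u}, ↑uu ⊆ Set.Iio (Cardinal.aleph 1).ord →
          ∃ h : I → V, ∀ γ ∈ uu, ({t : I | R (h t) (f γ t)} ∈ Dstar ↔ EvenOrdinal γ)) ∧
        ¬ ∃ h : I → V, ∀ γ, γ < (Cardinal.aleph 1).ord →
            ({t : I | R (h t) (f γ t)} ∈ Dstar ↔ EvenOrdinal γ) := by
  classical
  have hω : ℵ₀ ≤ lam := (aleph0_le_aleph 2).trans hlam
  have hInf : Infinite I := infinite_iff.2 (hI ▸ hω)
  let Ω : Type u := (Cardinal.aleph 1).ord.ToType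
  let Λ : Type u := (Order.succ lam).ord.ToType
  obtain ⟨G, F, D₁, hF, hne₁⟩ := exists_regular_filter_comap_nhds_inf_neBot (I := I)
    (K := (Ω × Bool) ⊕ Λ) (hI ▸ mk_paired_sum_le_two_power hlam)
  obtain ⟨D, hD, hne, hmax⟩ := exists_maximal_filter_comap_nhds_inf_neBot G D₁ hne₁
  have hdec := dense_decided_of_maximal hne hmax
  obtain ⟨W, hWF, hsmall⟩ := exists_ultrafilter_coordinates_small (unseparatedFilter Ω Λ)
    fun α n => tendsto_update_unseparatedFilter α n
  have hW : ∀ O : Set ((Ω × Bool) ⊕ Λ → ℕ), Dense (interior O) → O ∈ W :=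
    fun O hO => hWF (mem_unseparatedFilter_of_dense hO)
  obtain ⟨U, hU⟩ := exists_ultrafilter_mem_iff hne hdec hW
  refine ⟨U, ?_, fun S hS hcard => ?_, ?_⟩
  · exact isRegularFilter_of_mem hI F fun i =>
      (hU _).2 (univ_mem' fun x => mem_inf_of_right (hD (hF i)))
  · exact exists_nonstandard_below hω (fun B hB => exists_forall_lt_of_mk_lt
      (isRegular_succ hω) (hB.trans_lt (Order.lt_succ lam))) hne hdec hW hU hsmall S hS hcard
  have hV : Infinite V := infinite_of_extension hirr hrg
  let e : ℕ ↪ V := Infinite.natEmbedding V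
  obtain ⟨idx, hidx, hpair⟩ := exists_paired_index (aleph0_le_aleph 1)
  let f : Ordinal.{u} → I → V := fun γ t => e (G t (Sum.inl (idx γ)))
  have hf : ∀ γ < (Cardinal.aleph 1).ord, ∀ δ < (Cardinal.aleph 1).ord, γ ≠ δ →
      {t | f γ t ≠ f δ t} ∈ U := fun γ hγ δ hδ hne =>
    mem_of_superset (coordinate_ne_mem hWF hU (hidx.ne hγ hδ hne)) fun t ht h => ht (e.injective h)
  refine ⟨f, fun γ δ hγδ hδ => ?_, fun uu huu => ?_, ?_⟩
  · exact Ultrafilter.compl_mem_iff_notMem.1 (hf γ (hγδ.trans hδ) δ hδ hγδ.ne)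
  · exact exists_realization_of_finset hrg f uu
      (fun γ hγ δ hδ => hf γ (huu hγ) δ (huu hδ)) EvenOrdinal
  · rintro ⟨h, hh⟩
    obtain ⟨δ, hδ⟩ := exists_not_separated (fun B hB => exists_forall_lt_of_mk_lt
      isRegular_aleph_one (hB.le_aleph0.trans_lt aleph0_lt_aleph_one)) hne hdec hWF hU
      fun t u => R (h t) (e u)
    obtain ⟨β, hβ, hfalse, htrue⟩ := hpair δ
    rw [← hfalse, ← htrue] at hδ
    exact not_evenOrdinal_two_mul_add_one_s8 β ((hh _ hβ).1 (hδ ((hh _ ((lt_add_one _).trans hβ)).2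
      (evenOrdinal_two_mul β))))
end
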